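/- Suppose there exist λ > κ and an ℵ₀-guessing model M ≺ V_λ with κ_M = κ and otp(M ∩ λ) ≥ κ + 1. Then κ̄ = M ∩ κ is a huge cardinal, and κ is a limit of huge cardinals. -/

import Mathlib

open Cardinal

namespace GuessingModels

/-- First-order formulas in the language of set theory (membership and equality),
with `n` free variables. -/
inductive SF : ℕ → Type
  | mem {n} (i j : Fin n) : SF n
  | eq {n} (i j : Fin n) : SF n
  | imp {n} (f g : SF n) : SF n
  | not {n} (f : SF n) : SF n
  | ex {n} (f : SF (n + 1)) : SF n

/-- Tarskian satisfaction of a set-theoretic formula in the structure `⟨S, ∈⟩`,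
where `S` is a class of ZF sets. -/
def Realize (S : Set ZFSet) : ∀ {n}, SF n → (Fin n → ZFSet) → Prop
  | _, .mem i j, v => v i ∈ v j
  | _, .eq i j, v => v i = v j
  | _, .imp f g, v => Realize S f v → Realize S g v
  | _, .not f, v => ¬ Realize S f v
  | _, .ex f, v => ∃ x ∈ S, Realize S f (Fin.cons x v)

/-- `M ≺ R` : `M` is an elementary substructure of `⟨R, ∈⟩`. -/
def Prec (M R : Set ZFSet) : Prop :=
  M ⊆ R ∧ ∀ {n : ℕ} (φ : SF n) (v : Fin n → ZFSet), (∀ i, v i ∈ M) →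
    (Realize M φ v ↔ Realize R φ v)

/-- A (von Neumann) ordinal: a transitive set of transitive sets. -/
def IsOrd (x : ZFSet) : Prop :=
  x.IsTransitive ∧ ∀ y ∈ x, ZFSet.IsTransitive y

/-- `≤` on ordinals, i.e. `∈` or `=`. -/
def ole (a b : ZFSet) : Prop := a ∈ b ∨ a = b

/-- The cardinality of (the extension of) a ZF set. -/
noncomputable def card (x : ZFSet) : Cardinal := Cardinal.mk x.toSet

/-- A ZF set which is a cardinal: an ordinal not equinumerous with any of its members. -/
def IsCard (κ : ZFSet) : Prop := IsOrd κ ∧ ∀ β ∈ κ, card β < card κ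

/-- `s` (an external class) is a cofinal subset of the ordinal `κ`. -/
def CofinalSetIn (s : Set ZFSet) (κ : ZFSet) : Prop :=
  (∀ x ∈ s, x ∈ κ) ∧ ∀ β ∈ κ, ∃ γ ∈ s, ole β γ

/-- A regular cardinal: an infinite cardinal all of whose cofinal subsets have full size. -/
def IsRegCard (κ : ZFSet) : Prop :=
  IsCard κ ∧ ZFSet.omega ⊆ κ ∧
    ∀ s : Set ZFSet, CofinalSetIn s κ → Cardinal.mk s = card κ

/-- A strong limit ZF cardinal. -/
def IsStrongLimit (κ : ZFSet) : Prop := ∀ β ∈ κ, (2 : Cardinal) ^ card β < card κ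

/-- A strongly inaccessible cardinal: regular, uncountable and strong limit. -/
def IsInacc (κ : ZFSet) : Prop := IsRegCard κ ∧ ZFSet.omega ∈ κ ∧ IsStrongLimit κ

/-- The transitive closure of a ZF set, as a class. -/
def tcl (x : ZFSet) : Set ZFSet := {y | Relation.TransGen (· ∈ ·) y x}

/-- `H_θ` : the class of sets hereditarily of size `< θ`. -/
noncomputable def HSet (θ : ZFSet) : Set ZFSet := {x | Cardinal.mk (tcl x) < card θ}

/-- `V_α` as a class, for `α` an ordinal (as a ZF set): sets of rank `< α`. -/
noncomputable def VSet (α : ZFSet) : Set ZFSet := {x | x.rank < α.rank}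

/-- A suitable initial segment: `H_θ` for a regular cardinal `θ`, or a rank initial
segment `V_α`. -/
def Suitable (R : Set ZFSet) : Prop :=
  (∃ θ : ZFSet, IsRegCard θ ∧ R = HSet θ) ∨ (∃ α : ZFSet, IsOrd α ∧ R = VSet α)

/-- `κ = κ_M` : `κ` is the least ordinal in `M` with `M ∩ κ ≠ κ`. -/
def KappaSpec (M : Set ZFSet) (κ : ZFSet) : Prop :=
  IsOrd κ ∧ κ ∈ M ∧ (∃ β ∈ κ, β ∉ M) ∧
    ∀ α : ZFSet, IsOrd α → α ∈ M → (∃ β ∈ α, β ∉ M) → ole κ α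

/-- `d` is `(δ, M)`-approximated: `d ∩ Z ∈ M` for every `Z ∈ M` of size `< δ`. -/
noncomputable def Approx (M : Set ZFSet) (δ : Cardinal.{1}) (d : ZFSet) : Prop :=
  ∀ Z : ZFSet, Z ∈ M → card Z < δ → (d ∩ Z) ∈ M

/-- `d ⊆ X` is `M`-guessed: `d ∩ M = e ∩ M` for some `e ∈ M ∩ P(X)`. -/
def Guessed (M : Set ZFSet) (X d : ZFSet) : Prop :=
  ∃ e : ZFSet, e ∈ M ∧ e ⊆ X ∧ ∀ z ∈ M, (z ∈ e ↔ z ∈ d)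

/-- `M` is a `δ`-guessing model: every `(δ,M)`-approximated subset of any `X ∈ M`
is `M`-guessed. -/
noncomputable def GuessingModel (M : Set ZFSet) (δ : Cardinal.{1}) : Prop :=
  ∀ X ∈ M, ∀ d : ZFSet, d ⊆ X → Approx M δ d → Guessed M X d

/-- `M` is `ℵ₁`-internally unbounded: every countable subset of `M` is contained
in a countable element of `M`. -/
noncomputable def IntUnb (M : Set ZFSet) : Prop :=
  ∀ A : Set ZFSet, A ⊆ M → A.Countable → ∃ z ∈ M, card z ≤ ℵ₀ ∧ A ⊆ z.toSet


/-- `j : V → N` is an elementary embedding of the universe into the class `N`. -/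
def ClassElemEmb (N : Set ZFSet) (j : ZFSet → ZFSet) : Prop :=
  (∀ x, j x ∈ N) ∧ ∀ {n : ℕ} (φ : SF n) (v : Fin n → ZFSet),
    (Realize Set.univ φ v ↔ Realize N φ (fun i => j (v i)))

/-- A transitive class. -/
def ClassTransitive (N : Set ZFSet) : Prop := ∀ x ∈ N, ∀ y ∈ x, y ∈ N

/-- `κ` is a huge cardinal: there is `j : V → N` with `crit(j) = κ`, `N` transitive
and closed under `j(κ)`-sequences. -/
def IsHuge (κ : ZFSet) : Prop :=
  IsOrd κ ∧ ∃ (N : Set ZFSet) (j : ZFSet → ZFSet),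
    ClassTransitive N ∧ ClassElemEmb N j ∧
    (∀ β : ZFSet, IsOrd β → β ∈ κ → j β = β) ∧ κ ∈ j κ ∧ IsOrd (j κ) ∧
    ∀ f : ZFSet → ZFSet, (∀ x ∈ j κ, f x ∈ N) →
      ∃ F ∈ N, ∀ p : ZFSet, p ∈ F ↔ ∃ x, x ∈ j κ ∧ p = ZFSet.pair x (f x)

/-- The order type of the class of ordinals `A` is at least `γ`: there is a strictly
`∈`-increasing map from `γ` into `A`. -/
def OtpGe (A : Set ZFSet) (γ : ZFSet) : Prop :=
  ∃ f : ZFSet → ZFSet, (∀ x ∈ γ, f x ∈ A) ∧ ∀ x ∈ γ, ∀ y ∈ γ, x ∈ y → f x ∈ f y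

universe u

/-- A relation, formulated relative to a class `S`, is uniformly definable if a single formula
defines it in every transitive class. -/
def UDef {n : ℕ} (P : Set ZFSet.{u} → (Fin n → ZFSet.{u}) → Prop) : Prop :=
  ∃ φ : SF n, ∀ S, ClassTransitive S → ∀ v, (∀ i, v i ∈ S) → (Realize S φ v ↔ P S v)

namespace UDef

variable {n : ℕ} {P Q : Set ZFSet.{u} → (Fin n → ZFSet.{u}) → Prop}

theorem mem (i j : Fin n) :
    UDef (fun (_ : Set ZFSet.{u}) (v : Fin n → ZFSet.{u}) => v i ∈ v j) :=
  ⟨.mem i j, fun _ _ _ _ => Iff.rfl⟩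

theorem eq (i j : Fin n) :
    UDef (fun (_ : Set ZFSet.{u}) (v : Fin n → ZFSet.{u}) => v i = v j) :=
  ⟨.eq i j, fun _ _ _ _ => Iff.rfl⟩

theorem imp (hP : UDef P) (hQ : UDef Q) : UDef (fun S v => P S v → Q S v) := by
  obtain ⟨φ, hφ⟩ := hP
  obtain ⟨ψ, hψ⟩ := hQ
  exact ⟨.imp φ ψ, fun S hS v hv => imp_congr (hφ S hS v hv) (hψ S hS v hv)⟩

theorem not (hP : UDef P) : UDef (fun S v => ¬ P S v) := by
  obtain ⟨φ, hφ⟩ := hP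
  exact ⟨.not φ, fun S hS v hv => not_congr (hφ S hS v hv)⟩

theorem congr (hP : UDef P)
    (h : ∀ S, ClassTransitive S → ∀ v, (∀ i, v i ∈ S) → (P S v ↔ Q S v)) : UDef Q := by
  obtain ⟨φ, hφ⟩ := hP
  exact ⟨φ, fun S hS v hv => (hφ S hS v hv).trans (h S hS v hv)⟩

theorem and (hP : UDef P) (hQ : UDef Q) : UDef (fun S v => P S v ∧ Q S v) :=
  (hP.imp hQ.not).not.congr fun _ _ _ _ => by tauto

theorem or (hP : UDef P) (hQ : UDef Q) : UDef (fun S v => P S v ∨ Q S v) :=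
  (hP.not.imp hQ).congr fun _ _ _ _ => by tauto

theorem iff (hP : UDef P) (hQ : UDef Q) : UDef (fun S v => P S v ↔ Q S v) :=
  ((hP.imp hQ).and (hQ.imp hP)).congr fun _ _ _ _ => by tauto

variable {R : Set ZFSet.{u} → ZFSet.{u} → (Fin n → ZFSet.{u}) → Prop}

theorem ex (h : UDef (fun S (w : Fin (n + 1) → ZFSet.{u}) => R S (w 0) (Fin.tail w))) :
    UDef (fun S v => ∃ x ∈ S, R S x v) := by
  obtain ⟨φ, hφ⟩ := h
  refine ⟨.ex φ, fun S hS v hv => exists_congr fun x => and_congr_right fun hx => ?_⟩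
  simpa using hφ S hS (Fin.cons x v) (Fin.forall_fin_succ.2 ⟨hx, hv⟩)

theorem all (h : UDef (fun S (w : Fin (n + 1) → ZFSet.{u}) => R S (w 0) (Fin.tail w))) :
    UDef (fun S v => ∀ x ∈ S, R S x v) :=
  (ex (R := fun S x v => ¬ R S x v) h.not).not.congr fun _ _ _ _ => by push Not; rfl

theorem bex (i : Fin n)
    (h : UDef (fun S (w : Fin (n + 1) → ZFSet.{u}) => R S (w 0) (Fin.tail w))) :
    UDef (fun S v => ∃ x ∈ v i, R S x v) :=
  (ex (R := fun S x v => x ∈ v i ∧ R S x v) (and (mem 0 i.succ) h)).congr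
    fun _ hS _ hv => exists_congr fun x => ⟨fun h => h.2, fun h => ⟨hS _ (hv i) x h.1, h⟩⟩

theorem ball (i : Fin n)
    (h : UDef (fun S (w : Fin (n + 1) → ZFSet.{u}) => R S (w 0) (Fin.tail w))) :
    UDef (fun S v => ∀ x ∈ v i, R S x v) :=
  (bex i (R := fun S x v => ¬ R S x v) h.not).not.congr fun _ _ _ _ => by push Not; rfl

theorem eq_singleton (i j : Fin n) :
    UDef (fun (_ : Set ZFSet.{u}) (v : Fin n → ZFSet.{u}) => v i = {v j}) :=
  ((mem j i).and (ball i (R := fun _ x v => x = v j) (eq 0 j.succ))).congr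
    fun _ _ v _ => by
      constructor
      · rintro ⟨h, h'⟩
        ext z
        exact ⟨fun hz => ZFSet.mem_singleton.2 (h' z hz), fun hz => ZFSet.mem_singleton.1 hz ▸ h⟩
      · intro h
        simp [h]

theorem eq_doubleton (i j k : Fin n) :
    UDef (fun (_ : Set ZFSet.{u}) (v : Fin n → ZFSet.{u}) => v i = {v j, v k}) :=
  ((mem j i).and ((mem k i).and
    (ball i (R := fun _ x v => x = v j ∨ x = v k) (or (eq 0 j.succ) (eq 0 k.succ))))).congr
    fun _ _ v _ => by
      constructor
      · rintro ⟨h₁, h₂, h'⟩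
        ext z
        refine ⟨fun hz => ZFSet.mem_pair.2 (h' z hz), fun hz => ?_⟩
        rcases ZFSet.mem_pair.1 hz with rfl | rfl <;> assumption
      · intro h
        simp [h]

theorem eq_pair (i j k : Fin n) :
    UDef (fun (_ : Set ZFSet.{u}) (v : Fin n → ZFSet.{u}) => v i = ZFSet.pair (v j) (v k)) :=
  (bex i (R := fun _ s v => ∃ t ∈ v i, s = {v j} ∧ t = {v j, v k} ∧ v i = {s, t}) <|
    bex i.succ (R := fun _ t w => w 0 = {w j.succ} ∧ t = {w j.succ, w k.succ} ∧
      w i.succ = {w 0, t}) <|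
    (eq_singleton 1 j.succ.succ).and <| (eq_doubleton 0 j.succ.succ k.succ.succ).and <|
    eq_doubleton i.succ.succ 1 0).congr fun _ _ v _ => by
      constructor
      · rintro ⟨s, -, t, -, rfl, rfl, h⟩
        exact h
      · intro h
        refine ⟨_, ?_, _, ?_, rfl, rfl, h⟩ <;> simp [h, ZFSet.pair]

theorem pair_mem (i j k : Fin n) :
    UDef (fun (_ : Set ZFSet.{u}) (v : Fin n → ZFSet.{u}) => ZFSet.pair (v i) (v j) ∈ v k) :=
  (bex k (R := fun _ p v => p = ZFSet.pair (v i) (v j)) (eq_pair 0 i.succ j.succ)).congr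
    fun _ _ _ _ => by simp

end UDef

/-- First-order witness, inside the class `S`, that `μ` is huge with target `k`: the set `U`
generates an ultrafilter on `W` which concentrates on order-isomorphisms `e` between `μ` and subsets
of `k`, is fine and normal, and makes `e` fix every ordinal below `μ`. -/
structure HugeWitness (S : Set ZFSet.{u}) (μ k W U : ZFSet.{u}) : Prop where
  pair_mem : ∀ x ∈ W, ∀ y ∈ W, ∃ p ∈ W, p = ZFSet.pair x y
  subset : ∀ x ∈ μ, x ∈ W
  mem_target : μ ∈ k
  transitive : ∀ x ∈ k, ∀ y ∈ x, y ∈ k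
  transitive_mem : ∀ x ∈ k, ∀ y ∈ x, ∀ z ∈ y, z ∈ x
  limit : ∃ o ∈ μ, (∃ x ∈ o, x = x) ∧ ∀ x ∈ o, ∃ y ∈ o, x ∈ y
  subset_carrier : ∀ A ∈ U, ∀ e ∈ A, e ∈ W
  nonempty : ∀ A ∈ U, ∃ e ∈ A, e = e
  inter : ∀ A ∈ U, ∀ B ∈ U, ∃ C ∈ U, ∀ e ∈ C, e ∈ A ∧ e ∈ B
  ultra : ∀ A ∈ S, ∃ C ∈ U, (∀ e ∈ C, e ∈ A) ∨ (∀ e ∈ C, e ∉ A)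
  normal : ∀ f ∈ S, ∀ A ∈ U, (∀ e ∈ A, ∃ a ∈ μ, ZFSet.pair e a ∈ f) →
    ∃ ξ ∈ k, ∃ B ∈ U, ∀ e ∈ B, ∃ a ∈ μ, ZFSet.pair e a ∈ f ∧ ZFSet.pair a ξ ∈ e
  fine : ∀ ξ ∈ k, ∃ C ∈ U, ∀ e ∈ C, ∃ a ∈ μ, ZFSet.pair a ξ ∈ e
  order : ∃ C ∈ U, ∀ e ∈ C, ∀ a ∈ μ, ∀ b ∈ μ, ∀ ξ ∈ k, ∀ η ∈ k,
    ZFSet.pair a ξ ∈ e → ZFSet.pair b η ∈ e → (a ∈ b ↔ ξ ∈ η) ∧ (a = b ↔ ξ = η)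
  fixed : ∀ β ∈ μ, ∃ C ∈ U, ∀ e ∈ C, ∀ a ∈ β, ZFSet.pair a a ∈ e

section Formulas

variable {n : ℕ}

theorem UDef.limit (i : Fin n) :
    UDef (fun (_ : Set ZFSet.{u}) (v : Fin n → ZFSet.{u}) =>
      ∃ o ∈ v i, (∃ x ∈ o, x = x) ∧ ∀ x ∈ o, ∃ y ∈ o, x ∈ y) :=
  .bex i <| .and (.bex 0 <| .eq 0 0) (.ball 0 <| .bex 1 <| .mem 1 0)

theorem UDef.order_iso_mem (i j k : Fin n) :
    UDef (fun (_ : Set ZFSet.{u}) (v : Fin n → ZFSet.{u}) => ∀ a ∈ v i, ∀ b ∈ v i,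
      ∀ ξ ∈ v j, ∀ η ∈ v j, ZFSet.pair a ξ ∈ v k → ZFSet.pair b η ∈ v k →
        (a ∈ b ↔ ξ ∈ η) ∧ (a = b ↔ ξ = η)) :=
  .ball i <| .ball i.succ <| .ball j.succ.succ <| .ball j.succ.succ.succ <|
    (UDef.pair_mem 3 1 k.succ.succ.succ.succ).imp <|
    (UDef.pair_mem 2 0 k.succ.succ.succ.succ).imp <|
    ((UDef.mem 3 2).iff (.mem 1 0)).and ((UDef.eq 3 2).iff (.eq 1 0))

theorem UDef.hugeWitness (i j k l : Fin n) :
    UDef (fun S (v : Fin n → ZFSet.{u}) => HugeWitness S (v i) (v j) (v k) (v l)) := by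
  have h₁ : UDef (fun (_ : Set ZFSet.{u}) (v : Fin n → ZFSet.{u}) =>
      ∀ x ∈ v k, ∀ y ∈ v k, ∃ p ∈ v k, p = ZFSet.pair x y) :=
    .ball k <| .ball k.succ <| .bex k.succ.succ <| .eq_pair 0 2 1
  have h₂ : UDef (fun (_ : Set ZFSet.{u}) (v : Fin n → ZFSet.{u}) => ∀ x ∈ v i, x ∈ v k) :=
    .ball i <| .mem 0 k.succ
  have h₃ : UDef (fun (_ : Set ZFSet.{u}) (v : Fin n → ZFSet.{u}) =>
      ∀ x ∈ v j, ∀ y ∈ x, y ∈ v j) :=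
    .ball j <| .ball 0 <| .mem 0 j.succ.succ
  have h₄ : UDef (fun (_ : Set ZFSet.{u}) (v : Fin n → ZFSet.{u}) =>
      ∀ x ∈ v j, ∀ y ∈ x, ∀ z ∈ y, z ∈ x) :=
    .ball j <| .ball 0 <| .ball 0 <| .mem 0 2
  have h₅ : UDef (fun (_ : Set ZFSet.{u}) (v : Fin n → ZFSet.{u}) =>
      ∀ A ∈ v l, ∀ e ∈ A, e ∈ v k) :=
    .ball l <| .ball 0 <| .mem 0 k.succ.succ
  have h₆ : UDef (fun (_ : Set ZFSet.{u}) (v : Fin n → ZFSet.{u}) =>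
      ∀ A ∈ v l, ∃ e ∈ A, e = e) :=
    .ball l <| .bex 0 <| .eq 0 0
  have h₇ : UDef (fun (_ : Set ZFSet.{u}) (v : Fin n → ZFSet.{u}) =>
      ∀ A ∈ v l, ∀ B ∈ v l, ∃ C ∈ v l, ∀ e ∈ C, e ∈ A ∧ e ∈ B) :=
    .ball l <| .ball l.succ <| .bex l.succ.succ <| .ball 0 <| (UDef.mem 0 3).and (.mem 0 2)
  have h₈ : UDef (fun (S : Set ZFSet.{u}) (v : Fin n → ZFSet.{u}) =>
      ∀ A ∈ S, ∃ C ∈ v l, (∀ e ∈ C, e ∈ A) ∨ (∀ e ∈ C, e ∉ A)) :=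
    .all <| .bex l.succ <| .or (.ball 0 <| .mem 0 2) (.ball 0 <| .not <| .mem 0 2)
  have h₉ : UDef (fun (S : Set ZFSet.{u}) (v : Fin n → ZFSet.{u}) =>
      ∀ f ∈ S, ∀ A ∈ v l, (∀ e ∈ A, ∃ a ∈ v i, ZFSet.pair e a ∈ f) →
        ∃ ξ ∈ v j, ∃ B ∈ v l, ∀ e ∈ B, ∃ a ∈ v i,
          ZFSet.pair e a ∈ f ∧ ZFSet.pair a ξ ∈ e) :=
    .all <| .ball l.succ <| .imp
      (.ball 0 <| .bex i.succ.succ.succ <| .pair_mem 1 0 3) <|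
      .bex j.succ.succ <| .bex l.succ.succ.succ <| .ball 0 <| .bex i.succ.succ.succ.succ.succ <|
        (UDef.pair_mem 1 0 5).and (.pair_mem 0 3 1)
  have h₁₀ : UDef (fun (_ : Set ZFSet.{u}) (v : Fin n → ZFSet.{u}) =>
      ∀ ξ ∈ v j, ∃ C ∈ v l, ∀ e ∈ C, ∃ a ∈ v i, ZFSet.pair a ξ ∈ e) :=
    .ball j <| .bex l.succ <| .ball 0 <| .bex i.succ.succ.succ <| .pair_mem 0 3 1
  have h₁₁ : UDef (fun (_ : Set ZFSet.{u}) (v : Fin n → ZFSet.{u}) =>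
      ∃ C ∈ v l, ∀ e ∈ C, ∀ a ∈ v i, ∀ b ∈ v i, ∀ ξ ∈ v j, ∀ η ∈ v j,
        ZFSet.pair a ξ ∈ e → ZFSet.pair b η ∈ e → (a ∈ b ↔ ξ ∈ η) ∧ (a = b ↔ ξ = η)) :=
    .bex l <| .ball 0 <| .order_iso_mem i.succ.succ j.succ.succ 0
  have h₁₂ : UDef (fun (_ : Set ZFSet.{u}) (v : Fin n → ZFSet.{u}) =>
      ∀ β ∈ v i, ∃ C ∈ v l, ∀ e ∈ C, ∀ a ∈ β, ZFSet.pair a a ∈ e) :=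
    .ball i <| .bex l.succ <| .ball 0 <| .ball 2 <| .pair_mem 0 0 1
  refine (h₁.and <| h₂.and <| (UDef.mem i j).and <| h₃.and <| h₄.and <| (UDef.limit i).and <|
    h₅.and <| h₆.and <| h₇.and <| h₈.and <| h₉.and <| h₁₀.and <| h₁₁.and h₁₂).congr
    fun S _ v _ => ⟨?_, fun h => ?_⟩
  · rintro ⟨h₁, h₂, h₃, h₄, h₅, h₆, h₇, h₈, h₉, h₁₀, h₁₁, h₁₂, h₁₃, h₁₄⟩
    exact ⟨h₁, h₂, h₃, h₄, h₅, h₆, h₇, h₈, h₉, h₁₀, h₁₁, h₁₂, h₁₃, h₁₄⟩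
  · exact ⟨h.1, h.2, h.3, h.4, h.5, h.6, h.7, h.8, h.9, h.10, h.11, h.12, h.13, h.14⟩

end Formulas

section Mostowski

variable {α : Type*} (r : α → α → Prop) [IsWellFounded α r] [∀ a, Small.{u} {b // r b a}]

/-- The Mostowski collapse of a well-founded set-like relation. -/
noncomputable def mostowski : α → ZFSet.{u} :=
  IsWellFounded.fix r fun a ih => ZFSet.range fun b : {b // r b a} => ih b.1 b.2

variable {r}

theorem mem_mostowski {a : α} {y : ZFSet.{u}} :
    y ∈ mostowski r a ↔ ∃ b, r b a ∧ mostowski r b = y := by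
  rw [mostowski, IsWellFounded.fix_eq, ZFSet.mem_range]
  simp

theorem mostowski_injective (hext : ∀ a b, (∀ c, r c a ↔ r c b) → a = b) :
    Function.Injective (mostowski.{u} r) := by
  intro a
  induction a using IsWellFounded.induction r with
  | ind a ih =>
    intro b hab
    refine hext a b fun c => ⟨fun hc => ?_, fun hc => ?_⟩
    · obtain ⟨d, hd, hdc⟩ := mem_mostowski.1 (hab ▸ mem_mostowski.2 ⟨c, hc, rfl⟩)
      exact ih c hc hdc.symm ▸ hd
    · obtain ⟨d, hd, hdc⟩ := mem_mostowski.1 (hab.symm ▸ mem_mostowski.2 ⟨c, hc, rfl⟩)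
      exact ih d hd hdc ▸ hd

theorem mostowski_mem_iff (hext : ∀ a b, (∀ c, r c a ↔ r c b) → a = b) {a b : α} :
    mostowski.{u} r a ∈ mostowski r b ↔ r a b := by
  rw [mem_mostowski]
  exact ⟨fun ⟨c, hc, h⟩ => mostowski_injective hext h ▸ hc, fun h => ⟨a, h, rfl⟩⟩

theorem classTransitive_range_mostowski : ClassTransitive (Set.range (mostowski.{u} r)) := by
  rintro _ ⟨a, rfl⟩ y hy
  obtain ⟨b, -, rfl⟩ := mem_mostowski.1 hy
  exact ⟨b, rfl⟩

end Mostowski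

section Ultrapower

open Filter

variable {𝒰 : Ultrafilter ZFSet.{u}}

/-- The membership relation of the ultrapower of the universe. -/
def GermMem : Germ (𝒰 : Filter ZFSet.{u}) ZFSet.{u} → Germ (𝒰 : Filter ZFSet.{u}) ZFSet.{u} → Prop :=
  Germ.LiftRel (· ∈ ·)

theorem germMem_coe {f g : ZFSet.{u} → ZFSet.{u}} :
    GermMem (f : Germ (𝒰 : Filter ZFSet.{u}) ZFSet.{u}) g ↔ ∀ᶠ e in 𝒰, f e ∈ g e :=
  Iff.rfl

theorem germMem_ext (a b : Germ (𝒰 : Filter ZFSet.{u}) ZFSet.{u})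
    (h : ∀ c, GermMem c a ↔ GermMem c b) : a = b := by
  have key : ∀ f g : ZFSet.{u} → ZFSet.{u},
      (∀ h : ZFSet.{u} → ZFSet.{u}, (∀ᶠ e in 𝒰, h e ∈ f e) → ∀ᶠ e in 𝒰, h e ∈ g e) →
      ∀ᶠ e in 𝒰, f e ⊆ g e := by
    intro f g hfg
    by_contra hcon
    rw [← Ultrafilter.eventually_not] at hcon
    have : ∀ e, ∃ x, ¬ f e ⊆ g e → x ∈ f e ∧ x ∉ g e := by
      intro e
      by_cases he : f e ⊆ g e
      · exact ⟨∅, fun h => (h he).elim⟩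
      · obtain ⟨x, hx⟩ := not_forall.1 he
        exact ⟨x, fun _ => Classical.not_imp.1 hx⟩
    choose x hx using this
    have h₁ := hfg x (hcon.mono fun e he => (hx e he).1)
    obtain ⟨e, he, he'⟩ := (h₁.and hcon).exists
    exact (hx e he').2 he
  induction a using Germ.inductionOn with | _ f
  induction b using Germ.inductionOn with | _ g
  refine Germ.coe_eq.2 ?_
  filter_upwards [key f g fun c => (h c).1, key g f fun c => (h c).2] with e h₁ h₂
  exact subset_antisymm h₁ h₂

theorem small_germMem {W : ZFSet.{u}} (hW : ∀ᶠ e in 𝒰, e ∈ W)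
    (a : Germ (𝒰 : Filter ZFSet.{u}) ZFSet.{u}) : Small.{u} {b // GermMem b a} := by
  classical
  induction a using Germ.inductionOn with | _ f
  let V : ZFSet.{u} := ZFSet.iUnion fun e : W => f e
  let F : (W → V) → Germ (𝒰 : Filter ZFSet.{u}) ZFSet.{u} := fun c =>
    ((fun e => if he : e ∈ W then (c ⟨e, he⟩ : ZFSet.{u}) else ∅ : ZFSet.{u} → ZFSet.{u}) :
      Germ (𝒰 : Filter ZFSet.{u}) ZFSet.{u})
  have : Small.{u} (Set.range F) := inferInstance
  suffices {b | GermMem b (f : Germ (𝒰 : Filter ZFSet.{u}) ZFSet.{u})} ⊆ Set.range F from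
    small_subset.{u} this
  intro b hb
  induction b using Germ.inductionOn with | _ g
  have hg : ∀ᶠ e in 𝒰, e ∈ W ∧ g e ∈ f e := hW.and (germMem_coe.1 hb)
  obtain ⟨e₀, he₀⟩ := hg.exists
  have hV : ∀ e ∈ W, g e ∈ f e → g e ∈ V := fun e he h => ZFSet.mem_iUnion.2 ⟨⟨e, he⟩, h⟩
  refine ⟨fun e => if h : g e ∈ f e then ⟨g e, hV e e.2 h⟩ else ⟨g e₀, hV e₀ he₀.1 he₀.2⟩, ?_⟩
  refine Germ.coe_eq.2 ?_
  filter_upwards [hg] with e he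
  simp [he.1, he.2]

theorem wellFounded_germMem
    (h𝒰 : ∀ P : ℕ → ZFSet.{u} → Prop, (∀ n, ∀ᶠ e in 𝒰, P n e) → ∃ e, ∀ n, P n e) :
    IsWellFounded (Germ (𝒰 : Filter ZFSet.{u}) ZFSet.{u}) GermMem := by
  refine ⟨wellFounded_iff_isEmpty_descending_chain.2 ⟨?_⟩⟩
  rintro ⟨f, hf⟩
  have : ∀ n, ∃ g : ZFSet.{u} → ZFSet.{u}, (g : Germ (𝒰 : Filter ZFSet.{u}) ZFSet.{u}) = f n :=
    fun n => Quotient.exists_rep (f n)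
  choose g hg using this
  obtain ⟨e, he⟩ := h𝒰 (fun n e => g (n + 1) e ∈ g n e) fun n => by
    have := hf n
    rw [← hg, ← hg] at this
    exact germMem_coe.1 this
  exact (wellFounded_iff_isEmpty_descending_chain.1 ZFSet.mem_wf).false ⟨fun n => g n e, he⟩

variable [IsWellFounded (Germ (𝒰 : Filter ZFSet.{u}) ZFSet.{u}) GermMem]
  [∀ a : Germ (𝒰 : Filter ZFSet.{u}) ZFSet.{u}, Small.{u} {b // GermMem b a}]

variable (𝒰) in
/-- The element of the transitive collapse of the ultrapower represented by a function. -/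
noncomputable def ultraRep (f : ZFSet.{u} → ZFSet.{u}) : ZFSet.{u} :=
  mostowski GermMem (f : Germ (𝒰 : Filter ZFSet.{u}) ZFSet.{u})

theorem ultraRep_mem {f g : ZFSet.{u} → ZFSet.{u}} :
    ultraRep 𝒰 f ∈ ultraRep 𝒰 g ↔ ∀ᶠ e in 𝒰, f e ∈ g e :=
  mostowski_mem_iff germMem_ext

theorem ultraRep_eq {f g : ZFSet.{u} → ZFSet.{u}} :
    ultraRep 𝒰 f = ultraRep 𝒰 g ↔ ∀ᶠ e in 𝒰, f e = g e :=
  (mostowski_injective germMem_ext).eq_iff.trans Germ.coe_eq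

theorem mem_ultraRep {f : ZFSet.{u} → ZFSet.{u}} {y : ZFSet.{u}} :
    y ∈ ultraRep 𝒰 f ↔ ∃ g, (∀ᶠ e in 𝒰, g e ∈ f e) ∧ ultraRep 𝒰 g = y := by
  refine mem_mostowski.trans ⟨?_, fun ⟨g, hg⟩ => ⟨g, hg⟩⟩
  rintro ⟨b, hb, rfl⟩
  induction b using Germ.inductionOn with | _ g
  exact ⟨g, germMem_coe.1 hb, rfl⟩

theorem classTransitive_range_ultraRep : ClassTransitive (Set.range (ultraRep 𝒰)) := by
  rintro _ ⟨f, rfl⟩ y hy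
  obtain ⟨g, -, rfl⟩ := mem_ultraRep.1 hy
  exact ⟨g, rfl⟩

/-- Łoś's theorem. -/
theorem realize_ultraRep {n : ℕ} (φ : SF n) (v : Fin n → ZFSet.{u} → ZFSet.{u}) :
    Realize (Set.range (ultraRep 𝒰)) φ (fun i => ultraRep 𝒰 (v i)) ↔
      ∀ᶠ e in 𝒰, Realize Set.univ φ fun i => v i e := by
  induction φ with
  | mem i j => exact ultraRep_mem
  | eq i j => exact ultraRep_eq
  | imp φ ψ hφ hψ => exact (imp_congr (hφ v) (hψ v)).trans Ultrafilter.eventually_imp.symm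
  | not φ hφ => exact (not_congr (hφ v)).trans Ultrafilter.eventually_not.symm
  | ex φ hφ =>
    have cons_rep : ∀ g : ZFSet.{u} → ZFSet.{u},
        (Fin.cons (ultraRep 𝒰 g) fun i => ultraRep 𝒰 (v i) : Fin _ → ZFSet.{u}) =
          fun i => ultraRep 𝒰 ((Fin.cons g v : Fin _ → ZFSet.{u} → ZFSet.{u}) i) := by
      intro g
      ext1 i
      cases i using Fin.cases <;> rfl
    have cons_apply : ∀ (g : ZFSet.{u} → ZFSet.{u}) e,
        (fun i => (Fin.cons g v : Fin _ → ZFSet.{u} → ZFSet.{u}) i e) =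
          Fin.cons (g e) fun i => v i e := by
      intro g e
      ext1 i
      cases i using Fin.cases <;> rfl
    constructor
    · rintro ⟨_, ⟨g, rfl⟩, hg⟩
      rw [cons_rep, hφ] at hg
      refine hg.mono fun e he => ⟨g e, trivial, ?_⟩
      rwa [cons_apply] at he
    · intro h
      have : ∀ e, ∃ x, (∃ y ∈ Set.univ, Realize Set.univ φ (Fin.cons y fun i => v i e)) →
          Realize Set.univ φ (Fin.cons x fun i => v i e) := by
        intro e
        by_cases he : ∃ y ∈ Set.univ, Realize Set.univ φ (Fin.cons y fun i => v i e)
        · exact ⟨he.choose, fun _ => he.choose_spec.2⟩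
        · exact ⟨∅, fun h => (he h).elim⟩
      choose g hg using this
      refine ⟨_, ⟨g, rfl⟩, ?_⟩
      rw [cons_rep, hφ]
      refine h.mono fun e he => ?_
      rw [cons_apply]
      exact hg e he

theorem classElemEmb_ultraRep :
    ClassElemEmb (Set.range (ultraRep 𝒰)) fun x => ultraRep 𝒰 fun _ => x :=
  ⟨fun _ => ⟨_, rfl⟩, fun φ v => by
    rw [realize_ultraRep φ fun i _ => v i, eventually_const]⟩

theorem ultraRep_doubleton (f g : ZFSet.{u} → ZFSet.{u}) :
    ultraRep 𝒰 (fun e => {f e, g e}) = {ultraRep 𝒰 f, ultraRep 𝒰 g} := by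
  ext y
  rw [mem_ultraRep, ZFSet.mem_pair]
  constructor
  · rintro ⟨h, hh, rfl⟩
    simp only [ZFSet.mem_pair, Ultrafilter.eventually_or] at hh
    exact hh.imp ultraRep_eq.2 ultraRep_eq.2
  · rintro (rfl | rfl)
    · exact ⟨f, .of_forall fun _ => by simp, rfl⟩
    · exact ⟨g, .of_forall fun _ => by simp, rfl⟩

theorem ultraRep_pair (f g : ZFSet.{u} → ZFSet.{u}) :
    ultraRep 𝒰 (fun e => ZFSet.pair (f e) (g e)) =
      ZFSet.pair (ultraRep 𝒰 f) (ultraRep 𝒰 g) := by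
  have hs : ultraRep 𝒰 (fun e => {f e}) = {ultraRep 𝒰 f} := by
    simpa only [ZFSet.pair_eq_singleton] using ultraRep_doubleton f f
  change ultraRep 𝒰 (fun e => {{f e}, {f e, g e}}) = {{ultraRep 𝒰 f}, {ultraRep 𝒰 f, ultraRep 𝒰 g}}
  rw [ultraRep_doubleton (fun e => {f e}) fun e => {f e, g e}, hs, ultraRep_doubleton]

end Ultrapower

namespace HugeWitness

open Filter

variable {S : Set ZFSet.{u}} {μ k W U : ZFSet.{u}}

theorem isOrd_target (h : HugeWitness S μ k W U) : IsOrd k :=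
  ⟨fun x hx y hy => h.transitive x hx y hy, fun x hx y hy z hz => h.transitive_mem x hx y hy z hz⟩

theorem isOrd (h : HugeWitness S μ k W U) : IsOrd μ :=
  ⟨h.isOrd_target.2 μ h.mem_target, fun x hx =>
    h.isOrd_target.2 x (h.transitive μ h.mem_target x hx)⟩

theorem exists_ultrafilter (h : HugeWitness S μ k W U) (hS : ∀ x ∈ S, ∀ y ⊆ x, y ∈ S)
    (hW : W ∈ S) :
    ∃ 𝒰 : Ultrafilter ZFSet.{u}, ∀ P : ZFSet.{u} → Prop,
      (∀ᶠ e in 𝒰, P e) ↔ ∃ C ∈ U, ∀ e ∈ C, P e := by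
  let F : Filter ZFSet.{u} :=
    { sets := {A | ∃ C ∈ U, ∀ e ∈ C, e ∈ A}
      univ_sets := by
        obtain ⟨C, hC, -⟩ := h.fine μ h.mem_target
        exact ⟨C, hC, fun _ _ => trivial⟩
      sets_of_superset := fun ⟨C, hC, hCA⟩ hAB => ⟨C, hC, fun e he => hAB (hCA e he)⟩
      inter_sets := by
        rintro A B ⟨C, hC, hCA⟩ ⟨D, hD, hDB⟩
        obtain ⟨E, hE, hECD⟩ := h.inter C hC D hD
        exact ⟨E, hE, fun e he => ⟨hCA e (hECD e he).1, hDB e (hECD e he).2⟩⟩ }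
  refine ⟨Ultrafilter.ofComplNotMemIff F fun s => ⟨fun hs => ?_, ?_⟩, fun P => Iff.rfl⟩
  · obtain ⟨C, hC, hCs | hCs⟩ := h.ultra (W.sep (· ∈ s)) (hS W hW _ fun x hx => (ZFSet.mem_sep.1 hx).1)
    · exact ⟨C, hC, fun e he => (ZFSet.mem_sep.1 (hCs e he)).2⟩
    · exact (hs ⟨C, hC, fun e he hes =>
        hCs e he (ZFSet.mem_sep.2 ⟨h.subset_carrier C hC e he, hes⟩)⟩).elim
  · rintro ⟨C, hC, hCs⟩ ⟨D, hD, hDs⟩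
    obtain ⟨E, hE, hECD⟩ := h.inter C hC D hD
    obtain ⟨e, he, -⟩ := h.nonempty E hE
    exact hDs e (hECD e he).2 (hCs e (hECD e he).1)

variable {𝒰 : Ultrafilter ZFSet.{u}}

theorem eventually_pair_mem (h : HugeWitness S μ k W U) (hS : ∀ x ∈ S, ∀ y ⊆ x, y ∈ S)
    (hW : W ∈ S) (h𝒰 : ∀ P : ZFSet.{u} → Prop, (∀ᶠ e in 𝒰, P e) ↔ ∃ C ∈ U, ∀ e ∈ C, P e)
    {g : ZFSet.{u} → ZFSet.{u}} (hg : ∀ᶠ e in 𝒰, g e ∈ μ) :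
    ∃ ξ ∈ k, ∀ᶠ e in 𝒰, g e ∈ μ ∧ ZFSet.pair (g e) ξ ∈ e := by
  obtain ⟨A, hA, hAg⟩ := (h𝒰 _).1 hg
  obtain ⟨ξ, hξ, B, hB, hBg⟩ := h.normal (W.sep fun p => ∃ e, p = ZFSet.pair e (g e))
    (hS W hW _ fun x hx => (ZFSet.mem_sep.1 hx).1) A hA fun e he => by
      obtain ⟨p, hp, rfl⟩ := h.pair_mem e (h.subset_carrier A hA e he) (g e)
        (h.subset _ (hAg e he))
      exact ⟨g e, hAg e he, ZFSet.mem_sep.2 ⟨hp, e, rfl⟩⟩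
  refine ⟨ξ, hξ, (h𝒰 _).2 ⟨B, hB, fun e he => ?_⟩⟩
  obtain ⟨a, ha, hp, hpe⟩ := hBg e he
  obtain ⟨-, e', he'⟩ := ZFSet.mem_sep.1 hp
  obtain ⟨rfl, rfl⟩ := ZFSet.pair_inj.1 he'
  exact ⟨ha, hpe⟩

theorem eventually_const (h : HugeWitness S μ k W U) (hS : ∀ x ∈ S, ∀ y ⊆ x, y ∈ S)
    (hW : W ∈ S) (h𝒰 : ∀ P : ZFSet.{u} → Prop, (∀ᶠ e in 𝒰, P e) ↔ ∃ C ∈ U, ∀ e ∈ C, P e)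
    {β : ZFSet.{u}} (hβ : β ∈ μ) {g : ZFSet.{u} → ZFSet.{u}} (hg : ∀ᶠ e in 𝒰, g e ∈ β) :
    ∃ ξ ∈ β, ∀ᶠ e in 𝒰, g e = ξ := by
  have hβμ : ∀ x ∈ β, x ∈ μ := h.isOrd.1 β hβ
  obtain ⟨ξ, hξ, hgξ⟩ := h.eventually_pair_mem hS hW h𝒰 (hg.mono fun e he => hβμ _ he)
  have key : ∀ᶠ e in 𝒰, g e = ξ := by
    filter_upwards [hg, hgξ, (h𝒰 _).2 h.order, (h𝒰 _).2 (h.fixed β hβ)] with e h₁ h₂ h₃ h₄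
    exact ((h₃ _ h₂.1 _ h₂.1 _ hξ _ (h.transitive μ h.mem_target _ h₂.1) h₂.2
      (h₄ _ h₁)).2.1 rfl).symm
  obtain ⟨e, he, rfl⟩ := (hg.and key).exists
  exact ⟨_, he, key⟩

theorem countably_complete (h : HugeWitness S μ k W U) (hS : ∀ x ∈ S, ∀ y ⊆ x, y ∈ S)
    (hW : W ∈ S) (h𝒰 : ∀ P : ZFSet.{u} → Prop, (∀ᶠ e in 𝒰, P e) ↔ ∃ C ∈ U, ∀ e ∈ C, P e)
    (P : ℕ → ZFSet.{u} → Prop) (hP : ∀ n, ∀ᶠ e in 𝒰, P n e) : ∃ e, ∀ n, P n e := by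
  by_contra! hcon
  choose n hn using hcon
  obtain ⟨o, ho, ⟨x₀, hx₀, -⟩, hlim⟩ := h.limit
  choose! s hs hs' using hlim
  have hoμ : ∀ x ∈ o, x ∈ μ := h.isOrd.1 o ho
  let a : ℕ → ZFSet.{u} := fun m => s^[m] x₀
  have ha_succ : ∀ m, a (m + 1) = s (a m) := fun m => Function.iterate_succ_apply' s m x₀
  have ha : ∀ m, a m ∈ o := by
    intro m
    induction m with
    | zero => exact hx₀
    | succ m ih => exact ha_succ m ▸ hs _ ih
  have ha_lt : ∀ i j, i < j → a i ∈ a j := by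
    intro i j hij
    induction hij with
    | refl => exact ha_succ i ▸ hs' _ (ha i)
    | step _ ih => exact h.isOrd.2 _ (hoμ _ (ha _)) _ (ha_succ _ ▸ hs' _ (ha _)) ih
  obtain ⟨ξ, -, hξ⟩ := h.eventually_const hS hW h𝒰 ho (g := fun e => a (n e))
    (.of_forall fun e => ha _)
  obtain ⟨e₀, he₀⟩ := hξ.exists
  obtain ⟨e, he, he'⟩ := (hξ.and (hP (n e₀))).exists
  have hne : n e = n e₀ := by
    by_contra hne
    have heq : a (n e) = a (n e₀) := he.trans he₀.symm
    rcases lt_or_gt_of_ne hne with hlt | hlt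
    · exact ZFSet.mem_irrefl _ (heq ▸ ha_lt _ _ hlt)
    · exact ZFSet.mem_irrefl _ (heq ▸ ha_lt _ _ hlt)
  exact hn e (hne ▸ he')

section Collapse

variable [IsWellFounded (Germ (𝒰 : Filter ZFSet.{u}) ZFSet.{u}) GermMem]
  [∀ a : Germ (𝒰 : Filter ZFSet.{u}) ZFSet.{u}, Small.{u} {b // GermMem b a}]

theorem ultraRep_eq_of_pair_mem (h : HugeWitness S μ k W U) (hS : ∀ x ∈ S, ∀ y ⊆ x, y ∈ S)
    (hW : W ∈ S) (h𝒰 : ∀ P : ZFSet.{u} → Prop, (∀ᶠ e in 𝒰, P e) ↔ ∃ C ∈ U, ∀ e ∈ C, P e)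
    {ξ : ZFSet.{u}} (hξ : ξ ∈ k) {g : ZFSet.{u} → ZFSet.{u}}
    (hg : ∀ᶠ e in 𝒰, g e ∈ μ ∧ ZFSet.pair (g e) ξ ∈ e) : ultraRep 𝒰 g = ξ := by
  have horder := (h𝒰 _).2 h.order
  induction ξ using ZFSet.inductionOn generalizing g with | _ ξ ih
  ext y
  rw [mem_ultraRep]
  constructor
  · rintro ⟨f, hf, rfl⟩
    obtain ⟨η, hη, hfη⟩ := h.eventually_pair_mem hS hW h𝒰 (g := f) <| by
      filter_upwards [hf, hg] with e h₁ h₂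
      exact h.isOrd.1 _ h₂.1 h₁
    obtain ⟨e, h₁, h₂, h₃, h₄⟩ := (hf.and (hg.and (hfη.and horder))).exists
    have hηξ := (h₄ _ h₃.1 _ h₂.1 _ hη _ hξ h₃.2 h₂.2).1.1 h₁
    rwa [ih η hηξ hη hfη]
  · intro hy
    have hyk := h.transitive ξ hξ y hy
    obtain ⟨f, hf⟩ := Eventually.choice ((h𝒰 _).2 (h.fine y hyk))
    refine ⟨f, ?_, ih y hy hyk hf⟩
    filter_upwards [hf, hg, horder] with e h₁ h₂ h₃
    exact (h₃ _ h₁.1 _ h₂.1 _ hyk _ hξ h₁.2 h₂.2).1.2 hy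

theorem ultraRep_const_crit (h : HugeWitness S μ k W U) (hS : ∀ x ∈ S, ∀ y ⊆ x, y ∈ S)
    (hW : W ∈ S) (h𝒰 : ∀ P : ZFSet.{u} → Prop, (∀ᶠ e in 𝒰, P e) ↔ ∃ C ∈ U, ∀ e ∈ C, P e) :
    ultraRep 𝒰 (fun _ => μ) = k := by
  ext y
  rw [mem_ultraRep]
  constructor
  · rintro ⟨f, hf, rfl⟩
    obtain ⟨ξ, hξ, hfξ⟩ := h.eventually_pair_mem hS hW h𝒰 hf
    rwa [h.ultraRep_eq_of_pair_mem hS hW h𝒰 hξ hfξ]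
  · intro hy
    obtain ⟨f, hf⟩ := Eventually.choice ((h𝒰 _).2 (h.fine y hy))
    exact ⟨f, hf.mono fun e he => he.1, h.ultraRep_eq_of_pair_mem hS hW h𝒰 hy hf⟩

theorem ultraRep_const_of_mem (h : HugeWitness S μ k W U) (hS : ∀ x ∈ S, ∀ y ⊆ x, y ∈ S)
    (hW : W ∈ S) (h𝒰 : ∀ P : ZFSet.{u} → Prop, (∀ᶠ e in 𝒰, P e) ↔ ∃ C ∈ U, ∀ e ∈ C, P e)
    {β : ZFSet.{u}} (hβ : β ∈ μ) : ultraRep 𝒰 (fun _ => β) = β := by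
  induction β using ZFSet.inductionOn with | _ β ih
  ext y
  rw [mem_ultraRep]
  constructor
  · rintro ⟨f, hf, rfl⟩
    obtain ⟨ξ, hξ, hfξ⟩ := h.eventually_const hS hW h𝒰 hβ hf
    rwa [ultraRep_eq.2 hfξ, ih ξ hξ (h.isOrd.1 β hβ hξ)]
  · exact fun hy => ⟨fun _ => y, .of_forall fun _ => hy, ih y hy (h.isOrd.1 β hβ hy)⟩

theorem ultraRep_closed (h : HugeWitness S μ k W U) (hS : ∀ x ∈ S, ∀ y ⊆ x, y ∈ S)
    (hW : W ∈ S) (h𝒰 : ∀ P : ZFSet.{u} → Prop, (∀ᶠ e in 𝒰, P e) ↔ ∃ C ∈ U, ∀ e ∈ C, P e)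
    (f : ZFSet.{u} → ZFSet.{u}) (hf : ∀ x ∈ k, f x ∈ Set.range (ultraRep 𝒰)) :
    ∃ F ∈ Set.range (ultraRep 𝒰), ∀ p : ZFSet, p ∈ F ↔ ∃ x, x ∈ k ∧ p = ZFSet.pair x (f x) := by
  choose! F hF using hf
  let G : ZFSet.{u} → ZFSet.{u} := fun e =>
    ZFSet.range fun q : {q : μ × k // ZFSet.pair q.1 q.2 ∈ e} =>
      ZFSet.pair (q.1.1 : ZFSet.{u}) (F q.1.2 e)
  have hG : ∀ e p, p ∈ G e ↔ ∃ a ∈ μ, ∃ ξ ∈ k, ZFSet.pair a ξ ∈ e ∧ p = ZFSet.pair a (F ξ e) := by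
    intro e p
    rw [ZFSet.mem_range]
    constructor
    · rintro ⟨⟨⟨⟨a, ha⟩, ⟨ξ, hξ⟩⟩, hq⟩, rfl⟩
      exact ⟨a, ha, ξ, hξ, hq, rfl⟩
    · rintro ⟨a, ha, ξ, hξ, hq, rfl⟩
      exact ⟨⟨⟨⟨a, ha⟩, ⟨ξ, hξ⟩⟩, hq⟩, rfl⟩
  refine ⟨_, ⟨G, rfl⟩, fun p => ?_⟩
  rw [mem_ultraRep]
  constructor
  · rintro ⟨g, hg, rfl⟩
    simp only [hG] at hg
    obtain ⟨a, ha⟩ := Eventually.choice hg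
    obtain ⟨ξ, hξ, haξ⟩ := h.eventually_pair_mem hS hW h𝒰 (ha.mono fun e he => he.1)
    refine ⟨ξ, hξ, ?_⟩
    rw [← hF ξ hξ, ← h.ultraRep_eq_of_pair_mem hS hW h𝒰 hξ haξ, ← ultraRep_pair, ultraRep_eq]
    filter_upwards [ha, haξ, (h𝒰 _).2 h.order] with e h₁ h₂ h₃
    obtain ⟨ha', η, hη, hp, hge⟩ := h₁
    rw [hge, (h₃ _ ha' _ ha' _ hη _ hξ hp h₂.2).2.1 rfl,
      h.ultraRep_eq_of_pair_mem hS hW h𝒰 hξ haξ]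
  · rintro ⟨ξ, hξ, rfl⟩
    obtain ⟨a, ha⟩ := Eventually.choice ((h𝒰 _).2 (h.fine ξ hξ))
    refine ⟨fun e => ZFSet.pair (a e) (F ξ e), ?_, ?_⟩
    · filter_upwards [ha] with e he
      exact (hG _ _).2 ⟨_, he.1, ξ, hξ, he.2, rfl⟩
    · rw [ultraRep_pair, h.ultraRep_eq_of_pair_mem hS hW h𝒰 hξ ha, hF ξ hξ]

end Collapse

theorem isHuge (h : HugeWitness S μ k W U) (hS : ∀ x ∈ S, ∀ y ⊆ x, y ∈ S) (hW : W ∈ S) :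
    IsHuge μ := by
  obtain ⟨𝒰, h𝒰⟩ := h.exists_ultrafilter hS hW
  have := wellFounded_germMem (h.countably_complete hS hW h𝒰)
  have hW𝒰 : ∀ᶠ e in 𝒰, e ∈ W := by
    obtain ⟨C, hC, -⟩ := h.fine μ h.mem_target
    exact (h𝒰 _).2 ⟨C, hC, h.subset_carrier C hC⟩
  have := small_germMem hW𝒰
  have hk := h.ultraRep_const_crit hS hW h𝒰
  refine ⟨h.isOrd, Set.range (ultraRep 𝒰), fun x => ultraRep 𝒰 fun _ => x,
    classTransitive_range_ultraRep, classElemEmb_ultraRep,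
    fun β _ hβ => h.ultraRep_const_of_mem hS hW h𝒰 hβ, ?_⟩
  dsimp only
  rw [hk]
  exact ⟨h.mem_target, h.isOrd_target, h.ultraRep_closed hS hW h𝒰⟩

end HugeWitness

section Rename

/-- Substitution of variables in a formula. -/
def SF.rename : ∀ {n m : ℕ}, (Fin n → Fin m) → SF n → SF m
  | _, _, f, .mem i j => .mem (f i) (f j)
  | _, _, f, .eq i j => .eq (f i) (f j)
  | _, _, f, .imp φ ψ => .imp (φ.rename f) (ψ.rename f)
  | _, _, f, .not φ => .not (φ.rename f)
  | _, _, f, .ex φ => .ex (φ.rename (Fin.cons 0 (Fin.succ ∘ f)))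

theorem realize_rename {S : Set ZFSet.{u}} {n m : ℕ} (f : Fin n → Fin m) (φ : SF n)
    (v : Fin m → ZFSet.{u}) : Realize S (φ.rename f) v ↔ Realize S φ (v ∘ f) := by
  induction φ generalizing m with
  | mem i j => exact Iff.rfl
  | eq i j => exact Iff.rfl
  | imp φ ψ hφ hψ => exact imp_congr (hφ f v) (hψ f v)
  | not φ hφ => exact not_congr (hφ f v)
  | ex φ hφ =>
    refine exists_congr fun x => and_congr_right fun _ => (hφ _ _).trans (iff_of_eq ?_)
    congr 1
    ext1 i
    cases i using Fin.cases <;> rfl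

theorem UDef.rename {n m : ℕ} {P : Set ZFSet.{u} → (Fin n → ZFSet.{u}) → Prop} (hP : UDef P)
    (f : Fin n → Fin m) : UDef fun S v => P S (v ∘ f) := by
  obtain ⟨φ, hφ⟩ := hP
  exact ⟨φ.rename f, fun S hS v hv =>
    (realize_rename f φ v).trans (hφ S hS _ fun i => hv (f i))⟩

end Rename

/-- A class which contains all elements and all subsets of its members. -/
def Supertransitive (S : Set ZFSet.{u}) : Prop :=
  ClassTransitive S ∧ ∀ x ∈ S, ∀ y ⊆ x, y ∈ S

theorem supertransitive_VSet (α : ZFSet.{u}) : Supertransitive (VSet α) :=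
  ⟨fun _ hx _ hy => (ZFSet.rank_lt_of_mem hy).trans hx,
    fun _ hx _ hy => (ZFSet.rank_mono hy).trans_lt hx⟩

/-- An elementary embedding `j` of a supertransitive class `N` into `V_lam` with critical point `m`
and `j m = κ ∈ N`. -/
structure CritEmb (N : Set ZFSet.{u}) (lam : ZFSet.{u}) (j : ZFSet.{u} → ZFSet.{u})
    (m κ : ZFSet.{u}) : Prop where
  supertransitive : Supertransitive N
  map_mem : ∀ x ∈ N, j x ∈ VSet lam
  realize_iff : ∀ {n : ℕ} (φ : SF n) (v : Fin n → ZFSet.{u}), (∀ i, v i ∈ N) →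
    (Realize N φ v ↔ Realize (VSet lam) φ fun i => j (v i))
  isOrd : IsOrd κ
  crit_mem : m ∈ N
  target_mem : κ ∈ N
  map_crit : j m = κ
  crit_mem_target : m ∈ κ
  map_of_mem : ∀ β ∈ m, j β = β

/-- `W` is transitive and closed under pairs and powersets, relative to the class `S`. -/
structure Carrier (S : Set ZFSet.{u}) (W : ZFSet.{u}) : Prop where
  transitive : ∀ x ∈ W, ∀ y ∈ x, y ∈ W
  pair_mem : ∀ x ∈ W, ∀ y ∈ W, ∃ p ∈ W, p = ZFSet.pair x y
  powerset : ∀ x ∈ W, ∃ y ∈ W, ∀ z ∈ S, (∀ t ∈ z, t ∈ x) → z ∈ y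

/-- Every function in `S` from an element of `k` to `k` is bounded. -/
def BoundedMaps (S : Set ZFSet.{u}) (k : ZFSet.{u}) : Prop :=
  ∀ f ∈ S, ∀ a ∈ k,
    (∀ x ∈ a, ∀ y ∈ k, ∀ y' ∈ k, ZFSet.pair x y ∈ f → ZFSet.pair x y' ∈ f → y = y') →
    ∃ b ∈ k, (∀ x ∈ a, x ∈ b) ∧ ∀ x ∈ a, ∀ y ∈ k, ZFSet.pair x y ∈ f → y ∈ b

section Formulas

variable {n : ℕ}

theorem UDef.carrier (i : Fin n) :
    UDef fun (S : Set ZFSet.{u}) (v : Fin n → ZFSet.{u}) => Carrier S (v i) := by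
  have h₁ : UDef fun (_ : Set ZFSet.{u}) (v : Fin n → ZFSet.{u}) =>
      ∀ x ∈ v i, ∀ y ∈ x, y ∈ v i :=
    .ball i <| .ball 0 <| .mem 0 i.succ.succ
  have h₂ : UDef fun (_ : Set ZFSet.{u}) (v : Fin n → ZFSet.{u}) =>
      ∀ x ∈ v i, ∀ y ∈ v i, ∃ p ∈ v i, p = ZFSet.pair x y :=
    .ball i <| .ball i.succ <| .bex i.succ.succ <| .eq_pair 0 2 1
  have h₃ : UDef fun (S : Set ZFSet.{u}) (v : Fin n → ZFSet.{u}) =>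
      ∀ x ∈ v i, ∃ y ∈ v i, ∀ z ∈ S, (∀ t ∈ z, t ∈ x) → z ∈ y :=
    .ball i <| .bex i.succ <| .all <| .imp (.ball 0 <| .mem 0 3) (.mem 0 1)
  exact (h₁.and (h₂.and h₃)).congr fun S _ v _ =>
    ⟨fun ⟨h₁, h₂, h₃⟩ => ⟨h₁, h₂, h₃⟩, fun h => ⟨h.1, h.2, h.3⟩⟩

theorem UDef.functional (i j k : Fin n) :
    UDef fun (_ : Set ZFSet.{u}) (v : Fin n → ZFSet.{u}) => ∀ x ∈ v i, ∀ y ∈ v j, ∀ y' ∈ v j,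
      ZFSet.pair x y ∈ v k → ZFSet.pair x y' ∈ v k → y = y' :=
  .ball i <| .ball j.succ <| .ball j.succ.succ <| .imp (.pair_mem 2 1 k.succ.succ.succ) <|
    .imp (.pair_mem 2 0 k.succ.succ.succ) (.eq 1 0)

theorem UDef.bound (i j k : Fin n) :
    UDef fun (_ : Set ZFSet.{u}) (v : Fin n → ZFSet.{u}) => ∃ b ∈ v j, (∀ x ∈ v i, x ∈ b) ∧
      ∀ x ∈ v i, ∀ y ∈ v j, ZFSet.pair x y ∈ v k → y ∈ b :=
  .bex j <| .and (.ball i.succ <| .mem 0 1) <| .ball i.succ <| .ball j.succ.succ <|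
    .imp (.pair_mem 1 0 k.succ.succ.succ) (.mem 0 2)

theorem UDef.boundedMaps (i : Fin n) :
    UDef fun (S : Set ZFSet.{u}) (v : Fin n → ZFSet.{u}) => BoundedMaps S (v i) :=
  .all <| .ball i.succ <| .imp (.functional 0 i.succ.succ 1) (.bound 0 i.succ.succ 1)

theorem UDef.isOrd (i : Fin n) :
    UDef fun (_ : Set ZFSet.{u}) (v : Fin n → ZFSet.{u}) => IsOrd (v i) := by
  have h₁ : UDef fun (_ : Set ZFSet.{u}) (v : Fin n → ZFSet.{u}) =>
      ∀ x ∈ v i, ∀ y ∈ x, y ∈ v i :=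
    .ball i <| .ball 0 <| .mem 0 i.succ.succ
  have h₂ : UDef fun (_ : Set ZFSet.{u}) (v : Fin n → ZFSet.{u}) =>
      ∀ x ∈ v i, ∀ y ∈ x, ∀ z ∈ y, z ∈ x :=
    .ball i <| .ball 0 <| .ball 0 <| .mem 0 2
  exact (h₁.and h₂).congr fun S _ v _ =>
    ⟨fun h => ⟨fun x hx y hy => h.1 x hx y hy, fun x hx y hy z hz => h.2 x hx y hy z hz⟩,
      fun h => ⟨fun x hx y hy => h.1 x hx hy, fun x hx y hy z hz => h.2 x hx y hy hz⟩⟩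

theorem UDef.unbounded (i : Fin n) :
    UDef fun (_ : Set ZFSet.{u}) (v : Fin n → ZFSet.{u}) => ∀ x ∈ v i, ∃ y ∈ v i, x ∈ y :=
  .ball i <| .bex i.succ <| .mem 1 0

end Formulas

theorem Carrier.subset_mem {S : Set ZFSet.{u}} (hS : Supertransitive S) {W : ZFSet.{u}}
    (h : Carrier S W) (hW : W ∈ S) {x y : ZFSet.{u}} (hx : x ∈ W) (hy : y ⊆ x) : y ∈ W := by
  obtain ⟨z, hz, hz'⟩ := h.powerset x hx
  exact h.transitive z hz y (hz' y (hS.2 x (hS.1 W hW x hx) y hy) hy)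

namespace CritEmb

variable {N : Set ZFSet.{u}} {lam m κ : ZFSet.{u}} {j : ZFSet.{u} → ZFSet.{u}}

theorem iff (h : CritEmb N lam j m κ) {n : ℕ} {P : Set ZFSet.{u} → (Fin n → ZFSet.{u}) → Prop}
    (hP : UDef P) (v : Fin n → ZFSet.{u}) (hv : ∀ i, v i ∈ N) :
    P N v ↔ P (VSet lam) fun i => j (v i) := by
  obtain ⟨φ, hφ⟩ := hP
  rw [← hφ N h.supertransitive.1 v hv, h.realize_iff φ v hv,
    hφ _ (supertransitive_VSet lam).1 _ fun i => h.map_mem _ (hv i)]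

theorem map_mem_map (h : CritEmb N lam j m κ) {x y : ZFSet.{u}} (hx : x ∈ N) (hy : y ∈ N) :
    x ∈ y ↔ j x ∈ j y :=
  h.iff (UDef.mem 0 1) ![x, y] (by simp [Fin.forall_fin_succ, hx, hy])

theorem map_eq_map (h : CritEmb N lam j m κ) {x y : ZFSet.{u}} (hx : x ∈ N) (hy : y ∈ N) :
    x = y ↔ j x = j y :=
  h.iff (UDef.eq 0 1) ![x, y] (by simp [Fin.forall_fin_succ, hx, hy])

theorem map_pair_mem_map (h : CritEmb N lam j m κ) {x y z : ZFSet.{u}} (hx : x ∈ N) (hy : y ∈ N)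
    (hz : z ∈ N) : ZFSet.pair x y ∈ z ↔ ZFSet.pair (j x) (j y) ∈ j z :=
  h.iff (UDef.pair_mem 0 1 2) ![x, y, z] (by simp [Fin.forall_fin_succ, hx, hy, hz])

theorem rank_le_rank_map (h : CritEmb N lam j m κ) {x : ZFSet.{u}} (hx : x ∈ N) :
    x.rank ≤ (j x).rank := by
  induction x using ZFSet.inductionOn with | _ x ih
  refine ZFSet.rank_le_iff.2 fun {y} hy => ?_
  have hyN := h.supertransitive.1 x hx y hy
  exact (ih y hy hyN).trans_lt (ZFSet.rank_lt_of_mem ((h.map_mem_map hyN hx).1 hy))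

theorem mem_VSet (h : CritEmb N lam j m κ) {x : ZFSet.{u}} (hx : x ∈ N) : x ∈ VSet lam :=
  (h.rank_le_rank_map hx).trans_lt (h.map_mem x hx)

theorem mem_of_mem_crit (h : CritEmb N lam j m κ) {x : ZFSet.{u}} (hx : x ∈ m) : x ∈ N :=
  h.supertransitive.1 m h.crit_mem x hx

theorem mem_of_mem_target (h : CritEmb N lam j m κ) {x : ZFSet.{u}} (hx : x ∈ κ) : x ∈ N :=
  h.supertransitive.1 κ h.target_mem x hx

theorem target_mem_map (h : CritEmb N lam j m κ) : κ ∈ j κ := by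
  simpa only [h.map_crit] using (h.map_mem_map h.crit_mem h.target_mem).1 h.crit_mem_target

theorem isOrd_map (h : CritEmb N lam j m κ) : IsOrd (j κ) :=
  (h.iff (UDef.isOrd 0) ![κ] (by simp [h.target_mem])).1 h.isOrd

theorem transitive_crit (h : CritEmb N lam j m κ) {x y : ZFSet.{u}} (hx : x ∈ m) (hy : y ∈ x) :
    y ∈ m :=
  h.isOrd.2 m h.crit_mem_target x hx hy

theorem unbounded_crit (h : CritEmb N lam j m κ) : ∀ x ∈ m, ∃ y ∈ m, x ∈ y := by
  intro x hx
  have hP : UDef fun (_ : Set ZFSet.{u}) (v : Fin 2 → ZFSet.{u}) => ∃ y ∈ v 0, v 1 ∈ y :=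
    .bex 0 <| .mem 2 0
  refine (h.iff hP ![m, x]
    (by simp [Fin.forall_fin_succ, h.crit_mem, h.mem_of_mem_crit hx])).2 ?_
  change ∃ y ∈ j m, j x ∈ y
  rw [h.map_crit, h.map_of_mem x hx]
  exact ⟨m, h.crit_mem_target, hx⟩

theorem unbounded_target (h : CritEmb N lam j m κ) : ∀ x ∈ κ, ∃ y ∈ κ, x ∈ y := by
  simpa only [Matrix.cons_val_fin_one, h.map_crit] using
    (h.iff (UDef.unbounded 0) ![m] (by simp [h.crit_mem])).1 h.unbounded_crit

theorem unbounded_map (h : CritEmb N lam j m κ) : ∀ x ∈ j κ, ∃ y ∈ j κ, x ∈ y :=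
  (h.iff (UDef.unbounded 0) ![κ] (by simp [h.target_mem])).1 h.unbounded_target

theorem limit_crit (h : CritEmb N lam j m κ) :
    ∃ o ∈ m, (∃ x ∈ o, x = x) ∧ ∀ x ∈ o, ∃ y ∈ o, x ∈ y := by
  refine (h.iff (UDef.limit 0) ![m] (by simp [h.crit_mem])).2 ?_
  change ∃ o ∈ j m, _
  rw [h.map_crit]
  refine ⟨m, h.crit_mem_target, ?_, h.unbounded_crit⟩
  have hP : UDef fun (_ : Set ZFSet.{u}) (v : Fin 1 → ZFSet.{u}) => ∃ x ∈ v 0, x = x :=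
    .bex 0 <| .eq 0 0
  refine (h.iff hP ![m] (by simp [h.crit_mem])).2 ?_
  change ∃ x ∈ j m, x = x
  rw [h.map_crit]
  exact ⟨m, h.crit_mem_target, rfl⟩

theorem boundedMaps_crit (h : CritEmb N lam j m κ) : BoundedMaps N m := by
  intro f hf a ha hfun
  have haN := h.mem_of_mem_crit ha
  have hv : ∀ i, (![a, m, f] : Fin 3 → ZFSet.{u}) i ∈ N := by
    simp [Fin.forall_fin_succ, haN, h.crit_mem, hf]
  have hfun' := (h.iff (UDef.functional 0 1 2) ![a, m, f] hv).1 hfun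
  refine (h.iff (UDef.bound 0 1 2) ![a, m, f] hv).2 ?_
  change ∀ x ∈ j a, ∀ y ∈ j m, ∀ y' ∈ j m, ZFSet.pair x y ∈ j f → ZFSet.pair x y' ∈ j f → y = y'
    at hfun'
  change ∃ b ∈ j m, (∀ x ∈ j a, x ∈ b) ∧ ∀ x ∈ j a, ∀ y ∈ j m, ZFSet.pair x y ∈ j f → y ∈ b
  rw [h.map_crit, h.map_of_mem a ha] at hfun' ⊢
  refine ⟨m, h.crit_mem_target, fun x hx => h.transitive_crit ha hx, fun x hx y hy hxy => ?_⟩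
  have hxm := h.transitive_crit ha hx
  have hP : UDef fun (_ : Set ZFSet.{u}) (v : Fin 3 → ZFSet.{u}) =>
      ∃ y ∈ v 1, ZFSet.pair (v 0) y ∈ v 2 :=
    .bex 1 <| .pair_mem 1 0 3
  obtain ⟨y', hy', hxy'⟩ := (h.iff hP ![x, m, f] (by
    simp [Fin.forall_fin_succ, h.mem_of_mem_crit hxm, h.crit_mem, hf])).2 <| by
      change ∃ y ∈ j m, ZFSet.pair (j x) y ∈ j f
      rw [h.map_crit, h.map_of_mem x hxm]
      exact ⟨y, hy, hxy⟩
  replace hy' : y' ∈ m := hy'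
  have hxy'' := (h.map_pair_mem_map (h.mem_of_mem_crit hxm) (h.mem_of_mem_crit hy') hf).1 hxy'
  rw [h.map_of_mem x hxm, h.map_of_mem y' hy'] at hxy''
  rwa [hfun' x hx y hy y' (h.isOrd.1 m h.crit_mem_target hy') hxy hxy'']

theorem boundedMaps_map (h : CritEmb N lam j m κ) : BoundedMaps (VSet lam) (j κ) := by
  have h₁ : BoundedMaps (VSet lam) κ := by
    simpa only [Matrix.cons_val_fin_one, h.map_crit] using
      (h.iff (UDef.boundedMaps 0) ![m] (by simp [h.crit_mem])).1 h.boundedMaps_crit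
  exact (h.iff (UDef.boundedMaps 0) ![κ] (by simp [h.target_mem])).1
    fun f hf => h₁ f (h.mem_VSet hf)

theorem carrier_vonNeumann {S : Set ZFSet.{u}} {o : Ordinal.{u}} (ho : ∀ a < o, a + 1 < o) :
    Carrier S (ZFSet.vonNeumann o) where
  transitive x hx y hy := by
    rw [ZFSet.mem_vonNeumann] at hx ⊢
    exact (ZFSet.rank_lt_of_mem hy).trans hx
  pair_mem x hx y hy := by
    refine ⟨_, ?_, rfl⟩
    rw [ZFSet.mem_vonNeumann] at hx hy ⊢
    change ZFSet.rank {{x}, {x, y}} < o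
    simp only [ZFSet.rank_pair, ZFSet.rank_singleton, ← Order.succ_eq_add_one] at ho ⊢
    have hx' := ho _ hx
    have hxy := ho _ (max_lt hx' (ho _ hy))
    grind
  powerset x hx := by
    refine ⟨x.powerset, ?_, fun z _ hz => ZFSet.mem_powerset.2 fun t ht => hz t ht⟩
    rw [ZFSet.mem_vonNeumann] at hx ⊢
    rw [ZFSet.rank_powerset]
    exact ho _ hx

theorem exists_carrier (h : CritEmb N lam j m κ) :
    ∃ W ∈ N, Carrier N W ∧ (∀ x ∈ κ, x ∈ W) ∧ W.rank ≤ κ.rank := by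
  have hlim : ∀ k : ZFSet.{u}, (∀ x ∈ k, ∃ y ∈ k, x ∈ y) → ∀ a < k.rank, a + 1 < k.rank := by
    intro k hk a ha
    obtain ⟨x, hx, hax⟩ := ZFSet.lt_rank_iff.1 ha
    obtain ⟨y, hy, hxy⟩ := hk x hx
    exact (Order.add_one_le_of_lt (hax.trans_lt (ZFSet.rank_lt_of_mem hxy))).trans_lt
      (ZFSet.rank_lt_of_mem hy)
  have hP : UDef fun (S : Set ZFSet.{u}) (v : Fin 1 → ZFSet.{u}) =>
      ∃ W ∈ S, Carrier S W ∧ ∀ x ∈ v 0, x ∈ W :=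
    .ex <| (UDef.carrier 0).and <| .ball 1 <| .mem 0 1
  obtain ⟨W, hW, hWc, hκW⟩ := (h.iff hP ![κ] (by simp [h.target_mem])).2 <| by
    refine ⟨ZFSet.vonNeumann (j κ).rank, ?_, carrier_vonNeumann (hlim _ h.unbounded_map),
      fun x hx => ?_⟩
    · simpa [VSet] using h.map_mem κ h.target_mem
    · exact (ZFSet.mem_vonNeumann).2 (ZFSet.rank_lt_of_mem hx)
  replace hκW : ∀ x ∈ κ, x ∈ W := hκW
  have hκ := carrier_vonNeumann (S := N) (hlim κ h.unbounded_target)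
  have hmem : ∀ x, x ∈ W.sep (· ∈ ZFSet.vonNeumann κ.rank) ↔ x ∈ W ∧ x ∈ ZFSet.vonNeumann κ.rank :=
    fun x => ZFSet.mem_sep
  refine ⟨W.sep (· ∈ ZFSet.vonNeumann κ.rank),
    h.supertransitive.2 W hW _ fun x hx => ((hmem x).1 hx).1, ⟨?_, ?_, ?_⟩, ?_, ?_⟩
  · intro x hx y hy
    rw [hmem] at hx ⊢
    exact ⟨hWc.transitive x hx.1 y hy, hκ.transitive x hx.2 y hy⟩
  · intro x hx y hy
    rw [hmem] at hx hy
    obtain ⟨p, hp, rfl⟩ := hWc.pair_mem x hx.1 y hy.1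
    obtain ⟨q, hq, rfl⟩ := hκ.pair_mem x hx.2 y hy.2
    exact ⟨_, (hmem _).2 ⟨hp, hq⟩, rfl⟩
  · intro x hx
    rw [hmem] at hx
    obtain ⟨y, hy, hxy⟩ := hWc.powerset x hx.1
    obtain ⟨z, hz, hxz⟩ := hκ.powerset x hx.2
    refine ⟨y.sep (· ∈ z), (hmem _).2 ⟨hWc.subset_mem h.supertransitive hW hy
      fun t ht => (ZFSet.mem_sep.1 ht).1, ?_⟩, fun t ht htx =>
      ZFSet.mem_sep.2 ⟨hxy t ht htx, hxz t ht htx⟩⟩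
    rw [ZFSet.mem_vonNeumann] at hz ⊢
    exact (ZFSet.rank_mono fun t ht => (ZFSet.mem_sep.1 ht).2).trans_lt hz
  · exact fun x hx => (hmem x).2
      ⟨hκW x hx, ZFSet.mem_vonNeumann.2 (ZFSet.rank_lt_of_mem hx)⟩
  · exact ZFSet.rank_le_iff.2 fun {x} hx => ZFSet.mem_vonNeumann.1 ((hmem x).1 hx).2

end CritEmb

/-- The graph of `j` restricted to `x`. -/
noncomputable def graphOn (j : ZFSet.{u} → ZFSet.{u}) (x : ZFSet.{u}) : ZFSet.{u} :=
  ZFSet.range fun a : x => ZFSet.pair a (j a)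

theorem mem_graphOn {j : ZFSet.{u} → ZFSet.{u}} {x p : ZFSet.{u}} :
    p ∈ graphOn j x ↔ ∃ a ∈ x, ZFSet.pair a (j a) = p := by
  simp [graphOn]

theorem pair_mem_graphOn {j : ZFSet.{u} → ZFSet.{u}} {x a b : ZFSet.{u}} :
    ZFSet.pair a b ∈ graphOn j x ↔ a ∈ x ∧ b = j a := by
  rw [mem_graphOn]
  constructor
  · rintro ⟨c, hc, hp⟩
    obtain ⟨rfl, rfl⟩ := ZFSet.pair_inj.1 hp
    exact ⟨hc, rfl⟩
  · rintro ⟨ha, rfl⟩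
    exact ⟨a, ha, rfl⟩

namespace CritEmb

variable {N : Set ZFSet.{u}} {lam m κ W : ZFSet.{u}} {j : ZFSet.{u} → ZFSet.{u}}

theorem carrier_map (h : CritEmb N lam j m κ) (hWN : W ∈ N) (hW : Carrier N W) :
    Carrier (VSet lam) (j W) :=
  (h.iff (UDef.carrier 0) ![W] (by simp [hWN])).1 hW

theorem graphOn_mem_map (h : CritEmb N lam j m κ) (hWN : W ∈ N) (hW : Carrier N W)
    (hκW : ∀ x ∈ κ, x ∈ W) : graphOn j κ ∈ j W := by
  have hS := supertransitive_VSet lam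
  have hjW := h.carrier_map hWN hW
  have hjWL := h.map_mem W hWN
  have hδW : ∀ x ∈ j κ, x ∈ j W := by
    have hP : UDef fun (_ : Set ZFSet.{u}) (v : Fin 2 → ZFSet.{u}) => ∀ x ∈ v 0, x ∈ v 1 :=
      .ball 0 <| .mem 0 2
    exact (h.iff hP ![κ, W] (by simp [Fin.forall_fin_succ, h.target_mem, hWN])).1 hκW
  have hmap : ∀ a ∈ κ, j a ∈ j κ := fun a ha =>
    (h.map_mem_map (h.mem_of_mem_target ha) h.target_mem).1 ha
  have hs : graphOn j κ ∈ VSet lam := by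
    refine hS.2 _ hjWL _ fun p hp => ?_
    obtain ⟨a, ha, rfl⟩ := mem_graphOn.1 hp
    obtain ⟨q, hq, rfl⟩ := hjW.pair_mem a
      (hδW a (h.isOrd_map.1 κ h.target_mem_map ha)) (j a) (hδW _ (hmap a ha))
    exact hq
  obtain ⟨b, hb, hκb, hsb⟩ := h.boundedMaps_map _ hs κ h.target_mem_map
    fun x _ y _ y' _ hy hy' => (pair_mem_graphOn.1 hy).2.trans (pair_mem_graphOn.1 hy').2.symm
  obtain ⟨c, hc, hbc⟩ := hjW.powerset b (hδW b hb)
  obtain ⟨d, hd, hcd⟩ := hjW.powerset c hc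
  have hbL : b ∈ VSet lam := hS.1 _ hjWL b (hδW b hb)
  have hcL : c ∈ VSet lam := hS.1 _ hjWL c hc
  have hc' : ∀ z, (∀ t ∈ z, t ∈ b) → z ∈ c := fun z hz => hbc z (hS.2 b hbL z hz) hz
  have hd' : ∀ z, (∀ t ∈ z, t ∈ c) → z ∈ d := fun z hz => hcd z (hS.2 c hcL z hz) hz
  refine hjW.subset_mem hS hjWL hd fun p hp => ?_
  obtain ⟨a, ha, rfl⟩ := mem_graphOn.1 hp
  have hab := hκb a ha
  have hjab := hsb a ha _ (hmap a ha) hp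
  refine hd' _ fun t ht => hc' t fun z hz => ?_
  rw [ZFSet.pair, ZFSet.mem_pair] at ht
  rcases ht with rfl | rfl
  · rwa [ZFSet.mem_singleton.1 hz]
  · rcases ZFSet.mem_pair.1 hz with rfl | rfl
    exacts [hab, hjab]

theorem mem_map_sep_iff (h : CritEmb N lam j m κ) (hWN : W ∈ N) {n : ℕ}
    {P : Set ZFSet.{u} → (Fin (n + 1) → ZFSet.{u}) → Prop} (hP : UDef P)
    (v : Fin n → ZFSet.{u}) (hv : ∀ i, v i ∈ N) {s : ZFSet.{u}} (hs : s ∈ j W) :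
    s ∈ j (W.sep fun e => P N (Fin.cons e v)) ↔
      P (VSet lam) (Fin.cons s fun i => j (v i)) := by
  have hsep : W.sep (fun e => P N (Fin.cons e v)) ∈ N :=
    h.supertransitive.2 W hWN _ fun x hx => (ZFSet.mem_sep.1 hx).1
  let ι : Fin (n + 1) → Fin (n + 3) := Fin.cons 0 fun i => i.succ.succ.succ
  have hQ : UDef fun S (w : Fin (n + 2) → ZFSet.{u}) =>
      ∀ e ∈ w 0, e ∈ w 1 ↔ P S ((Fin.cons e w : Fin (n + 3) → ZFSet.{u}) ∘ ι) :=
    .ball 0 <| (UDef.mem 0 2).iff <| (hP.rename ι).congr fun S _ w _ => by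
      rw [Fin.cons_self_tail]
  have hι : ∀ (e a b : ZFSet.{u}) (w : Fin n → ZFSet.{u}),
      (Fin.cons e (Fin.cons a (Fin.cons b w : Fin (n + 1) → ZFSet.{u}) : Fin (n + 2) → ZFSet.{u}) :
        Fin (n + 3) → ZFSet.{u}) ∘ ι = Fin.cons e w := by
    intro e a b w
    ext1 i
    cases i using Fin.cases <;> rfl
  have hcons : ∀ (a b : ZFSet.{u}),
      (fun i => j ((Fin.cons a (Fin.cons b v : Fin (n + 1) → ZFSet.{u}) :
        Fin (n + 2) → ZFSet.{u}) i)) =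
        Fin.cons (j a) (Fin.cons (j b) fun i => j (v i) : Fin (n + 1) → ZFSet.{u}) := by
    intro a b
    ext1 i
    cases i using Fin.cases with
    | zero => rfl
    | succ i => cases i using Fin.cases <;> rfl
  have key := (h.iff hQ (Fin.cons W (Fin.cons (W.sep fun e => P N (Fin.cons e v)) v :
    Fin (n + 1) → ZFSet.{u})) (by simp [Fin.forall_fin_succ, hWN, hsep, hv])).1 <| by
      intro e he
      rw [hι]
      exact (ZFSet.mem_sep (p := fun e => P N (Fin.cons e v))).trans (and_iff_right he)
  rw [hcons] at key
  have := key s hs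
  rwa [hι] at this

/-- The normal ultrafilter derived from `j` and the graph of `j` on `κ`. -/
noncomputable def derived (j : ZFSet.{u} → ZFSet.{u}) (κ W : ZFSet.{u}) : ZFSet.{u} :=
  W.powerset.sep fun A => graphOn j κ ∈ j A

theorem mem_derived {A : ZFSet.{u}} : A ∈ derived j κ W ↔ A ⊆ W ∧ graphOn j κ ∈ j A := by
  rw [derived, ZFSet.mem_sep, ZFSet.mem_powerset]

theorem exists_mem_derived (h : CritEmb N lam j m κ) (hWN : W ∈ N) (hW : Carrier N W)
    (hκW : ∀ x ∈ κ, x ∈ W) {n : ℕ} {P : Set ZFSet.{u} → (Fin (n + 1) → ZFSet.{u}) → Prop}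
    (hP : UDef P) (v : Fin n → ZFSet.{u}) (hv : ∀ i, v i ∈ N)
    (hs : P (VSet lam) (Fin.cons (graphOn j κ) fun i => j (v i))) :
    ∃ C ∈ derived j κ W, ∀ e ∈ C, P N (Fin.cons e v) :=
  ⟨_, mem_derived.2 ⟨fun _ hx => (ZFSet.mem_sep.1 hx).1,
    (h.mem_map_sep_iff hWN hP v hv (h.graphOn_mem_map hWN hW hκW)).2 hs⟩,
    fun _ he => (ZFSet.mem_sep.1 he).2⟩

theorem hugeWitness (h : CritEmb N lam j m κ) (hWN : W ∈ N) (hW : Carrier N W)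
    (hκW : ∀ x ∈ κ, x ∈ W) : HugeWitness (VSet lam) m κ W (derived j κ W) where
  pair_mem := hW.pair_mem
  subset x hx := hκW x (h.isOrd.1 m h.crit_mem_target hx)
  mem_target := h.crit_mem_target
  transitive x hx y hy := h.isOrd.1 x hx hy
  transitive_mem x hx y hy z hz := h.isOrd.2 x hx y hy hz
  limit := h.limit_crit
  subset_carrier A hA e he := (mem_derived.1 hA).1 he
  nonempty A hA := by
    have hP : UDef fun (_ : Set ZFSet.{u}) (v : Fin 1 → ZFSet.{u}) => ∃ e ∈ v 0, e = e :=
      .bex 0 <| .eq 0 0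
    have hAN : A ∈ N := h.supertransitive.2 W hWN A (mem_derived.1 hA).1
    exact (h.iff hP ![A] (by simp [hAN])).2 ⟨_, (mem_derived.1 hA).2, rfl⟩
  inter A hA B hB := by
    have hAN : A ∈ N := h.supertransitive.2 W hWN A (mem_derived.1 hA).1
    have hBN : B ∈ N := h.supertransitive.2 W hWN B (mem_derived.1 hB).1
    have hP : UDef fun (_ : Set ZFSet.{u}) (v : Fin 3 → ZFSet.{u}) => v 0 ∈ v 1 ∧ v 0 ∈ v 2 :=
      (UDef.mem 0 1).and (.mem 0 2)
    exact h.exists_mem_derived hWN hW hκW hP ![A, B] (by simp [Fin.forall_fin_succ, hAN, hBN])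
      ⟨(mem_derived.1 hA).2, (mem_derived.1 hB).2⟩
  ultra A _ := by
    have hAN : W ∩ A ∈ N :=
      h.supertransitive.2 W hWN _ fun x hx => (ZFSet.mem_inter.1 hx).1
    by_cases hs : graphOn j κ ∈ j (W ∩ A)
    · exact ⟨_, mem_derived.2 ⟨fun x hx => (ZFSet.mem_inter.1 hx).1, hs⟩,
        .inl fun e he => (ZFSet.mem_inter.1 he).2⟩
    · have hP : UDef fun (_ : Set ZFSet.{u}) (v : Fin 2 → ZFSet.{u}) => v 0 ∉ v 1 := .not (.mem 0 1)
      obtain ⟨C, hC, hCA⟩ := h.exists_mem_derived hWN hW hκW hP ![W ∩ A] (by simp [hAN]) hs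
      exact ⟨C, hC, .inr fun e he heA =>
        hCA e he (ZFSet.mem_inter.2 ⟨(mem_derived.1 hC).1 he, heA⟩)⟩
  normal f _ A hA hAf := by
    have hAN : A ∈ N := h.supertransitive.2 W hWN A (mem_derived.1 hA).1
    have hfN : W ∩ f ∈ N :=
      h.supertransitive.2 W hWN _ fun x hx => (ZFSet.mem_inter.1 hx).1
    have hP : UDef fun (_ : Set ZFSet.{u}) (v : Fin 3 → ZFSet.{u}) =>
        ∀ e ∈ v 0, ∃ a ∈ v 1, ZFSet.pair e a ∈ v 2 :=
      .ball 0 <| .bex 2 <| .pair_mem 1 0 4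
    have hAf' := (h.iff hP ![A, m, W ∩ f]
      (by simp [Fin.forall_fin_succ, hAN, h.crit_mem, hfN])).1 <| by
        intro e he
        obtain ⟨a, ha, hea⟩ := hAf e he
        obtain ⟨p, hp, rfl⟩ := hW.pair_mem e ((mem_derived.1 hA).1 he) a
          (hκW a (h.isOrd.1 m h.crit_mem_target ha))
        exact ⟨a, ha, ZFSet.mem_inter.2 ⟨hp, hea⟩⟩
    change ∀ e ∈ j A, ∃ a ∈ j m, ZFSet.pair e a ∈ j (W ∩ f) at hAf'
    rw [h.map_crit] at hAf'
    obtain ⟨ξ, hξ, hsξ⟩ := hAf' _ (mem_derived.1 hA).2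
    have hQ : UDef fun (_ : Set ZFSet.{u}) (v : Fin 4 → ZFSet.{u}) =>
        ∃ a ∈ v 1, ZFSet.pair (v 0) a ∈ v 2 ∧ ZFSet.pair a (v 3) ∈ v 0 :=
      .bex 1 <| (UDef.pair_mem 1 0 3).and (.pair_mem 0 4 1)
    obtain ⟨C, hC, hCP⟩ := h.exists_mem_derived hWN hW hκW hQ ![m, W ∩ f, ξ]
      (by simp [Fin.forall_fin_succ, h.mem_of_mem_target hξ, h.crit_mem, hfN]) <| by
        change ∃ a ∈ j m, ZFSet.pair (graphOn j κ) a ∈ j (W ∩ f) ∧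
          ZFSet.pair a (j ξ) ∈ graphOn j κ
        rw [h.map_crit]
        exact ⟨ξ, hξ, hsξ, pair_mem_graphOn.2 ⟨hξ, rfl⟩⟩
    refine ⟨ξ, hξ, C, hC, fun e he => ?_⟩
    obtain ⟨a, ha, hea, hp⟩ := hCP e he
    exact ⟨a, ha, (ZFSet.mem_inter.1 hea).2, hp⟩
  fine ξ hξ := by
    have hP : UDef fun (_ : Set ZFSet.{u}) (v : Fin 3 → ZFSet.{u}) =>
        ∃ a ∈ v 1, ZFSet.pair a (v 2) ∈ v 0 :=
      .bex 1 <| .pair_mem 0 3 1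
    refine h.exists_mem_derived hWN hW hκW hP ![m, ξ]
      (by simp [Fin.forall_fin_succ, h.mem_of_mem_target hξ, h.crit_mem]) ?_
    change ∃ a ∈ j m, ZFSet.pair a (j ξ) ∈ graphOn j κ
    rw [h.map_crit]
    exact ⟨ξ, hξ, pair_mem_graphOn.2 ⟨hξ, rfl⟩⟩
  order := by
    refine h.exists_mem_derived hWN hW hκW (UDef.order_iso_mem 1 2 0) ![m, κ]
      (by simp [Fin.forall_fin_succ, h.target_mem, h.crit_mem]) ?_
    intro a _ b _ ξ _ η _ haξ hbη
    obtain ⟨ha, rfl⟩ := pair_mem_graphOn.1 haξ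
    obtain ⟨hb, rfl⟩ := pair_mem_graphOn.1 hbη
    exact ⟨h.map_mem_map (h.mem_of_mem_target ha) (h.mem_of_mem_target hb),
      h.map_eq_map (h.mem_of_mem_target ha) (h.mem_of_mem_target hb)⟩
  fixed β hβ := by
    have hP : UDef fun (_ : Set ZFSet.{u}) (v : Fin 2 → ZFSet.{u}) =>
        ∀ a ∈ v 1, ZFSet.pair a a ∈ v 0 :=
      .ball 1 <| .pair_mem 0 0 1
    refine h.exists_mem_derived hWN hW hκW hP ![β] (by simp [h.mem_of_mem_crit hβ]) ?_
    change ∀ a ∈ j β, ZFSet.pair a a ∈ graphOn j κ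
    rw [h.map_of_mem β hβ]
    intro a ha
    have ham := h.transitive_crit hβ ha
    exact pair_mem_graphOn.2 ⟨h.isOrd.1 m h.crit_mem_target ham, (h.map_of_mem a ham).symm⟩

theorem exists_hugeWitness (h : CritEmb N lam j m κ) :
    ∃ W ∈ VSet lam, ∃ U ∈ VSet lam, HugeWitness (VSet lam) m κ W U := by
  obtain ⟨W, hWN, hW, hκW, hrank⟩ := h.exists_carrier
  refine ⟨W, h.mem_VSet hWN, derived j κ W, ?_, h.hugeWitness hWN hW hκW⟩
  calc (derived j κ W).rank ≤ W.powerset.rank :=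
        ZFSet.rank_mono fun _ hx => (ZFSet.mem_sep.1 hx).1
    _ ≤ (j κ).rank := by
      rw [ZFSet.rank_powerset]
      exact Order.add_one_le_of_lt (hrank.trans_lt (ZFSet.rank_lt_of_mem h.target_mem_map))
    _ < lam.rank := h.map_mem κ h.target_mem

theorem isHuge_crit (h : CritEmb N lam j m κ) : IsHuge m := by
  obtain ⟨W, hW, U, -, hU⟩ := h.exists_hugeWitness
  exact hU.isHuge (supertransitive_VSet lam).2 hW

theorem isHuge_unbounded (h : CritEmb N lam j m κ) :
    ∀ β ∈ κ, ∃ μ, β ∈ μ ∧ μ ∈ κ ∧ IsHuge μ := by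
  have hW : UDef fun (S : Set ZFSet.{u}) (v : Fin 2 → ZFSet.{u}) => ∃ μ ∈ v 1, v 0 ∈ μ ∧
      ∃ k ∈ S, ∃ W ∈ S, ∃ U ∈ S, HugeWitness S μ k W U :=
    .bex 1 <| (UDef.mem 1 0).and <| .ex <| .ex <| .ex <| .hugeWitness 3 2 1 0
  have hall : UDef fun (S : Set ZFSet.{u}) (v : Fin 1 → ZFSet.{u}) => ∀ β ∈ v 0, ∃ μ ∈ v 0, β ∈ μ ∧
      ∃ k ∈ S, ∃ W ∈ S, ∃ U ∈ S, HugeWitness S μ k W U :=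
    .ball 0 <| .bex 1 <| (UDef.mem 1 0).and <| .ex <| .ex <| .ex <| .hugeWitness 3 2 1 0
  have key := (h.iff hall ![m] (by simp [h.crit_mem])).1 <| by
    intro β hβ
    refine (h.iff hW ![β, m]
      (by simp [Fin.forall_fin_succ, h.crit_mem, h.mem_of_mem_crit hβ])).2 ?_
    change ∃ μ ∈ j m, j β ∈ μ ∧ _
    rw [h.map_crit, h.map_of_mem β hβ]
    exact ⟨m, h.crit_mem_target, hβ, κ, h.mem_VSet h.target_mem, h.exists_hugeWitness⟩
  change ∀ β ∈ j m, ∃ μ ∈ j m, β ∈ μ ∧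
    ∃ k ∈ VSet lam, ∃ W ∈ VSet lam, ∃ U ∈ VSet lam, HugeWitness (VSet lam) μ k W U at key
  rw [h.map_crit] at key
  intro β hβ
  obtain ⟨μ, hμ, hβμ, k, -, W, hW, U, -, hU⟩ := key β hβ
  exact ⟨μ, hβμ, hμ, hU.isHuge (supertransitive_VSet lam).2 hW⟩

end CritEmb

theorem IsOrd.isOrdinal {x : ZFSet.{u}} (hx : IsOrd x) : x.IsOrdinal :=
  ZFSet.isOrdinal_iff_forall_mem_isTransitive.2 hx

theorem IsOrd.of_mem {x y : ZFSet.{u}} (hx : IsOrd x) (hy : y ∈ x) : IsOrd y :=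
  ⟨hx.2 y hy, fun z hz => hx.2 z (hx.1 y hy hz)⟩

namespace Prec

section

variable {M : Set ZFSet.{u}} {lam : ZFSet.{u}}

/-- The Tarski-Vaught criterion for uniformly definable relations. -/
theorem exists_mem (hM : Prec M (VSet lam)) {n : ℕ}
    {P : Set ZFSet.{u} → (Fin (n + 1) → ZFSet.{u}) → Prop} (hP : UDef P)
    (v : Fin n → ZFSet.{u}) (hv : ∀ i, v i ∈ M) {x : ZFSet.{u}} (hx : x ∈ VSet lam)
    (h : P (VSet lam) (Fin.cons x v)) : ∃ y ∈ M, P (VSet lam) (Fin.cons y v) := by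
  obtain ⟨φ, hφ⟩ := hP
  have hS := (supertransitive_VSet lam).1
  have hcons : ∀ {S : Set ZFSet.{u}} {y : ZFSet.{u}}, y ∈ S → (∀ i, v i ∈ S) →
      ∀ i, (Fin.cons y v : Fin (n + 1) → ZFSet.{u}) i ∈ S :=
    fun hy hv => Fin.forall_fin_succ.2 ⟨hy, hv⟩
  obtain ⟨y, hy, hyφ⟩ := (hM.2 (.ex φ) v hv).2
    ⟨x, hx, (hφ _ hS _ (hcons hx fun i => hM.1 (hv i))).2 h⟩
  exact ⟨y, hy, (hφ _ hS _ (hcons (hM.1 hy) fun i => hM.1 (hv i))).1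
    ((hM.2 φ _ (hcons hy hv)).1 hyφ)⟩

theorem subset_of_forall_mem (hM : Prec M (VSet lam)) {x y : ZFSet.{u}} (hx : x ∈ M) (hy : y ∈ M)
    (h : ∀ z ∈ M, z ∈ x → z ∈ y) : x ⊆ y := by
  intro z hz
  by_contra hzy
  have hP : UDef fun (_ : Set ZFSet.{u}) (v : Fin 3 → ZFSet.{u}) => v 0 ∈ v 1 ∧ v 0 ∉ v 2 :=
    (UDef.mem 0 1).and <| .not <| .mem 0 2
  obtain ⟨t, ht, htx, hty⟩ := hM.exists_mem hP ![x, y] (by simp [Fin.forall_fin_succ, hx, hy])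
    ((supertransitive_VSet lam).1 x (hM.1 hx) z hz) ⟨hz, hzy⟩
  exact hty (h t ht htx)

theorem eq_of_forall_mem_iff (hM : Prec M (VSet lam)) {x y : ZFSet.{u}} (hx : x ∈ M) (hy : y ∈ M)
    (h : ∀ z ∈ M, z ∈ x ↔ z ∈ y) : x = y :=
  subset_antisymm (hM.subset_of_forall_mem hx hy fun z hz => (h z hz).1)
    (hM.subset_of_forall_mem hy hx fun z hz => (h z hz).2)

theorem sep_ne_mem (hM : Prec M (VSet lam)) {x z : ZFSet.{u}} (hx : x ∈ M) (hz : z ∈ M) :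
    x.sep (· ≠ z) ∈ M := by
  have hP : UDef fun (_ : Set ZFSet.{u}) (v : Fin 3 → ZFSet.{u}) =>
      (∀ t ∈ v 0, t ∈ v 1 ∧ t ≠ v 2) ∧ ∀ t ∈ v 1, t ≠ v 2 → t ∈ v 0 :=
    .and (.ball 0 <| (UDef.mem 0 2).and <| .not <| .eq 0 3)
      (.ball 1 <| .imp (.not <| .eq 0 3) (.mem 0 1))
  obtain ⟨y, hy, hyx, hxy⟩ := hM.exists_mem hP ![x, z] (by simp [Fin.forall_fin_succ, hx, hz])
    (x := x.sep (· ≠ z))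
    ((supertransitive_VSet lam).2 x (hM.1 hx) _ fun t ht => (ZFSet.mem_sep.1 ht).1)
    (show (∀ t ∈ x.sep (· ≠ z), t ∈ x ∧ t ≠ z) ∧ ∀ t ∈ x, t ≠ z → t ∈ x.sep (· ≠ z) from
      ⟨fun t ht => ZFSet.mem_sep.1 ht, fun t ht htz => ZFSet.mem_sep.2 ⟨ht, htz⟩⟩)
  convert hy
  ext t
  exact ZFSet.mem_sep.trans ⟨fun ht => hxy t ht.1 ht.2, hyx t⟩

theorem insert_mem (hM : Prec M (VSet lam)) {x z : ZFSet.{u}} (hx : x ∈ M) (hz : z ∈ M)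
    (h : insert z x ∈ VSet lam) : insert z x ∈ M := by
  have hP : UDef fun (_ : Set ZFSet.{u}) (v : Fin 3 → ZFSet.{u}) =>
      (∀ t ∈ v 0, t = v 2 ∨ t ∈ v 1) ∧ v 2 ∈ v 0 ∧ ∀ t ∈ v 1, t ∈ v 0 :=
    .and (.ball 0 <| (UDef.eq 0 3).or <| .mem 0 2) <| .and (.mem 2 0) (.ball 1 <| .mem 0 1)
  obtain ⟨y, hy, h₁, h₂, h₃⟩ := hM.exists_mem hP ![x, z]
    (by simp [Fin.forall_fin_succ, hx, hz]) h
    ⟨fun t ht => ZFSet.mem_insert_iff.1 ht, ZFSet.mem_insert z x,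
      fun t ht => ZFSet.mem_insert_of_mem z ht⟩
  convert hy
  ext t
  rw [ZFSet.mem_insert_iff]
  exact ⟨by rintro (rfl | ht); exacts [h₂, h₃ t ht], h₁ t⟩

theorem mem_of_subset_finite (hM : Prec M (VSet lam)) {x d : ZFSet.{u}} (hx : x ∈ M)
    (hfin : (x : Set ZFSet.{u}).Finite) (hd : d ⊆ x) : d ∈ M := by
  have hS := supertransitive_VSet lam
  induction hn : (x : Set ZFSet.{u}).ncard generalizing x d with
  | zero =>
    have hempty : ∀ z, z ∉ x := fun z hz =>
      Set.eq_empty_iff_forall_notMem.1 ((Set.ncard_eq_zero hfin).1 hn) z hz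
    convert hx
    ext z
    exact iff_of_false (fun hz => hempty z (hd hz)) (hempty z)
  | succ n ih =>
    obtain ⟨z₀, hz₀⟩ := Set.nonempty_of_ncard_ne_zero (hn.trans_ne n.succ_ne_zero)
    obtain ⟨z, hz, hzx⟩ := hM.exists_mem (UDef.mem 0 1) ![x] (by simp [hx])
      (hS.1 x (hM.1 hx) z₀ hz₀) hz₀
    replace hzx : z ∈ x := hzx
    have hcoe : (x.sep (· ≠ z) : Set ZFSet.{u}) = (x : Set ZFSet.{u}) \ {z} := by
      ext t
      exact ZFSet.mem_sep
    have hd' : d.sep (· ≠ z) ∈ M := by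
      refine ih (hM.sep_ne_mem hx hz) (hcoe ▸ hfin.subset Set.sdiff_subset) (fun t ht => ?_) ?_
      · exact ZFSet.mem_sep.2 ⟨hd (ZFSet.mem_sep.1 ht).1, (ZFSet.mem_sep.1 ht).2⟩
      · rw [hcoe, Set.ncard_sdiff_singleton_of_mem hzx, hn, Nat.add_sub_cancel]
    by_cases hzd : z ∈ d
    · have heq : d = insert z (d.sep (· ≠ z)) := by
        ext t
        rw [ZFSet.mem_insert_iff, ZFSet.mem_sep]
        by_cases ht : t = z <;> simp [ht, hzd]
      rw [heq]
      exact hM.insert_mem hd' hz (heq ▸ hS.2 x (hM.1 hx) d hd)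
    · convert hd'
      ext t
      rw [ZFSet.mem_sep]
      exact ⟨fun ht => ⟨ht, by rintro rfl; exact hzd ht⟩, And.left⟩

end

theorem guessed {M : Set ZFSet.{0}} {lam X d : ZFSet.{0}} (hM : Prec M (VSet lam))
    (hG : GuessingModel M ℵ₀) (hX : X ∈ M) (hd : d ⊆ X) : Guessed M X d :=
  hG X hX d hd fun _ hZ hcard => hM.mem_of_subset_finite hZ
    (Cardinal.lt_aleph0_iff_set_finite.1 hcard) fun _ ht => (ZFSet.mem_inter.1 ht).2

end Prec

section Collapse

variable {M : Set ZFSet.{u}}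

/-- Membership restricted to a class. -/
def MemOn (M : Set ZFSet.{u}) (a b : M) : Prop := (a : ZFSet.{u}) ∈ (b : ZFSet.{u})

instance : IsWellFounded M (MemOn M) :=
  ⟨InvImage.wf _ ZFSet.mem_wf⟩

instance (a : M) : Small.{u} {b // MemOn M b a} :=
  small_of_injective (β := (a : ZFSet.{u})) (f := fun b => ⟨b.1.1, b.2⟩)
    fun _ _ h => Subtype.ext <| Subtype.ext <| congrArg (fun y : (a : ZFSet.{u}) => (y : ZFSet.{u})) h

/-- The transitive collapse of a class. -/
noncomputable def collapse (M : Set ZFSet.{u}) (a : M) : ZFSet.{u} :=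
  mostowski (MemOn M) a

theorem mem_collapse {a : M} {y : ZFSet.{u}} :
    y ∈ collapse M a ↔ ∃ b : M, (b : ZFSet.{u}) ∈ (a : ZFSet.{u}) ∧ collapse M b = y :=
  mem_mostowski

theorem classTransitive_range_collapse : ClassTransitive (Set.range (collapse M)) :=
  classTransitive_range_mostowski

theorem isOrd_collapse {a : M} (ha : IsOrd a) : IsOrd (collapse M a) := by
  constructor
  · intro y hy z hz
    obtain ⟨b, hb, rfl⟩ := mem_collapse.1 hy
    obtain ⟨c, hc, rfl⟩ := mem_collapse.1 hz
    exact mem_collapse.2 ⟨c, ha.1 _ hb hc, rfl⟩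
  · intro x hx y hy z hz
    obtain ⟨b, hb, rfl⟩ := mem_collapse.1 hx
    obtain ⟨c, hc, rfl⟩ := mem_collapse.1 hy
    obtain ⟨d, hd, rfl⟩ := mem_collapse.1 hz
    exact mem_collapse.2 ⟨d, ha.2 _ hb _ hc hd, rfl⟩

theorem collapse_eq_self (x : ZFSet.{u}) (hx : x ∈ M)
    (h : ∀ y, Relation.TransGen (· ∈ ·) y x → y ∈ M) :
    collapse M ⟨x, hx⟩ = x := by
  induction x using ZFSet.inductionOn with | _ x ih
  have hy : ∀ y (hy : y ∈ x), collapse M ⟨y, h y (.single hy)⟩ = y := fun y hy =>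
    ih y hy _ fun z hz => h z (hz.tail hy)
  ext y
  rw [mem_collapse]
  constructor
  · rintro ⟨⟨b, hbM⟩, hb, rfl⟩
    rwa [hy b hb]
  · exact fun hyx => ⟨⟨y, h y (.single hyx)⟩, hyx, hy y hyx⟩

variable {lam : ZFSet.{u}}

theorem Prec.collapse_injective (hM : Prec M (VSet lam)) : Function.Injective (collapse M) :=
  mostowski_injective fun a b h =>
    Subtype.ext <| hM.eq_of_forall_mem_iff a.2 b.2 fun z hz => h ⟨z, hz⟩

theorem Prec.collapse_mem_iff (hM : Prec M (VSet lam)) {a b : M} :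
    collapse M a ∈ collapse M b ↔ (a : ZFSet.{u}) ∈ (b : ZFSet.{u}) :=
  mostowski_mem_iff fun a b h =>
    Subtype.ext <| hM.eq_of_forall_mem_iff a.2 b.2 fun z hz => h ⟨z, hz⟩

theorem Prec.realize_collapse (hM : Prec M (VSet lam)) {n : ℕ} (φ : SF n) (v : Fin n → M) :
    Realize (Set.range (collapse M)) φ (fun i => collapse M (v i)) ↔
      Realize M φ fun i => (v i : ZFSet.{u}) := by
  induction φ with
  | mem i j => exact hM.collapse_mem_iff
  | eq i j => exact hM.collapse_injective.eq_iff.trans Subtype.ext_iff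
  | imp φ ψ hφ hψ => exact imp_congr (hφ v) (hψ v)
  | not φ hφ => exact not_congr (hφ v)
  | ex φ hφ =>
    have hcons : ∀ {α : Type (u + 1)} (g : M → α) (a : M),
        (fun i => g ((Fin.cons a v : Fin _ → M) i)) = Fin.cons (g a) fun i => g (v i) := by
      intro α g a
      ext1 i
      cases i using Fin.cases <;> rfl
    constructor
    · rintro ⟨_, ⟨a, rfl⟩, ha⟩
      rw [← hcons (collapse M), hφ, hcons] at ha
      exact ⟨a, a.2, ha⟩
    · rintro ⟨a, haM, ha⟩
      refine ⟨_, ⟨⟨a, haM⟩, rfl⟩, ?_⟩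
      rw [← hcons (collapse M), hφ, hcons]
      exact ha

end Collapse

theorem supertransitive_range_collapse {M : Set ZFSet.{0}} {lam : ZFSet.{0}}
    (hM : Prec M (VSet lam)) (hG : GuessingModel M ℵ₀) :
    Supertransitive (Set.range (collapse M)) := by
  refine ⟨classTransitive_range_collapse, ?_⟩
  rintro _ ⟨a, rfl⟩ y hy
  obtain ⟨e, he, hea, hed⟩ := hM.guessed hG a.2
    (d := (a : ZFSet).sep fun b => ∃ h : b ∈ M, collapse M ⟨b, h⟩ ∈ y)
    fun _ ht => (ZFSet.mem_sep.1 ht).1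
  refine ⟨⟨e, he⟩, ?_⟩
  ext t
  rw [mem_collapse]
  constructor
  · rintro ⟨b, hb, rfl⟩
    exact (ZFSet.mem_sep.1 ((hed b b.2).1 hb)).2.2
  · intro ht
    obtain ⟨b, hb, rfl⟩ := mem_collapse.1 (hy ht)
    exact ⟨b, (hed b b.2).2 (ZFSet.mem_sep.2 ⟨hb, b.2, ht⟩), rfl⟩

theorem exists_critEmb {M : Set ZFSet.{0}} {lam κ : ZFSet.{0}} (hlam : IsOrd lam)
    (hM : Prec M (VSet lam)) (hG : GuessingModel M ℵ₀) (hκ : KappaSpec M κ)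
    (hotp : OtpGe {x | x ∈ M ∧ x ∈ lam} (insert κ κ)) :
    ∃ N j m, CritEmb N lam j m κ ∧ ∀ x, x ∈ m ↔ x ∈ M ∧ x ∈ κ := by
  obtain ⟨hord, hκM, ⟨β₀, hβ₀, hβ₀M⟩, hleast⟩ := hκ
  have hsub : ∀ β ∈ κ, β ∈ M → ∀ γ ∈ β, γ ∈ M := by
    intro β hβ hβM
    by_contra! hcon
    rcases hleast β (hord.of_mem hβ) hβM hcon with h | rfl
    · exact ZFSet.mem_asymm h hβ
    · exact ZFSet.mem_irrefl _ hβ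
  have hfix : ∀ β (_ : β ∈ κ) (hβM : β ∈ M), collapse M ⟨β, hβM⟩ = β := by
    intro β hβ hβM
    refine collapse_eq_self β hβM fun y hy => hsub β hβ hβM y ?_
    induction hy using Relation.TransGen.head_induction_on with
    | single h => exact h
    | head h _ ih => exact hord.2 β hβ _ ih h
  have hm : ∀ x, x ∈ collapse M ⟨κ, hκM⟩ ↔ x ∈ M ∧ x ∈ κ := by
    intro x
    rw [mem_collapse]
    constructor
    · rintro ⟨⟨b, hbM⟩, hb, rfl⟩
      rw [hfix b hb hbM]
      exact ⟨hbM, hb⟩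
    · exact fun ⟨hxM, hx⟩ => ⟨⟨x, hxM⟩, hx, hfix x hx hxM⟩
  have : Nonempty M := ⟨⟨κ, hκM⟩⟩
  choose! j hj using fun (y : ZFSet.{0}) (hy : y ∈ Set.range (collapse M)) => hy
  have hj' : ∀ a : M, (j (collapse M a) : ZFSet) = a := fun a =>
    congrArg Subtype.val (hM.collapse_injective (hj _ ⟨a, rfl⟩))
  refine ⟨Set.range (collapse M), fun y => j y, collapse M ⟨κ, hκM⟩, ?_, hm⟩
  refine ⟨supertransitive_range_collapse hM hG, fun x _ => hM.1 (j x).2, fun φ v hv => ?_, hord,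
    ⟨_, rfl⟩, ?_, hj' _, ?_, fun β hβ => ?_⟩
  · rw [← hM.2 φ _ fun i => (j (v i)).2, ← hM.realize_collapse φ fun i => j (v i)]
    simp only [hj _ (hv _)]
  · obtain ⟨f, hf, hf'⟩ := hotp
    have hκ' : κ ∈ insert κ κ := ZFSet.mem_insert κ κ
    have hlift : ∀ x (hx : x ∈ insert κ κ),
        x.rank ≤ (collapse M ⟨f x, (hf x hx).1⟩).rank := by
      intro x
      induction x using ZFSet.inductionOn with | _ x ih
      intro hx
      refine ZFSet.rank_le_iff.2 fun {y} hy => ?_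
      have hyκ : y ∈ insert κ κ := by
        refine ZFSet.mem_insert_of_mem κ ?_
        rcases ZFSet.mem_insert_iff.1 hx with rfl | hx
        exacts [hy, hord.1 x hx hy]
      exact (ih y hy hyκ).trans_lt
        (ZFSet.rank_lt_of_mem (hM.collapse_mem_iff.2 (hf' y hyκ x hx hy)))
    have hord' := isOrd_collapse (a := (⟨f κ, (hf κ hκ').1⟩ : M)) (hlam.of_mem (hf κ hκ').2)
    rcases (hord.isOrdinal.subset_iff_eq_or_mem hord'.isOrdinal).1
      ((hord.isOrdinal.rank_le_iff_subset hord'.isOrdinal).1 (hlift κ hκ')) with h | h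
    · exact ⟨_, h.symm⟩
    · exact classTransitive_range_collapse _ ⟨_, rfl⟩ κ h
  · have hord' := isOrd_collapse (a := (⟨κ, hκM⟩ : M)) hord
    refine ((hord'.isOrdinal.subset_iff_eq_or_mem hord.isOrdinal).1
      fun x hx => ((hm x).1 hx).2).resolve_left fun h => hβ₀M ?_
    exact ((hm β₀).1 (h.symm ▸ hβ₀)).1
  · obtain ⟨hβM, hβκ⟩ := (hm β).1 hβ
    have := hj' ⟨β, hβM⟩
    rwa [hfix β hβκ hβM] at this

/-- Lemma 3.7(2): if there are `λ > κ` and an `ℵ₀`-guessing model `M ≺ V_λ` with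
`κ_M = κ` and `otp(M ∩ λ) ≥ κ + 1`, then `κ̄ = M ∩ κ` is huge and `κ` is a limit
of huge cardinals. -/
theorem guessing_huge_limit (κ lam : ZFSet) (hlam : IsOrd lam) (hκlam : κ ∈ lam)
    (M : Set ZFSet) (hM : Prec M (VSet lam)) (hG : GuessingModel M ℵ₀)
    (hκ : KappaSpec M κ) (hotp : OtpGe {x | x ∈ M ∧ x ∈ lam} (insert κ κ)) :
    (∃ κb : ZFSet, κb.toSet = M ∩ κ.toSet ∧ IsHuge κb) ∧
      ∀ β ∈ κ, ∃ μ : ZFSet, β ∈ μ ∧ μ ∈ κ ∧ IsHuge μ := by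
  obtain ⟨N, j, m, h, hm⟩ := exists_critEmb hlam hM hG hκ hotp
  exact ⟨⟨m, Set.ext hm, h.isHuge_crit⟩, h.isHuge_unbounded⟩

end GuessingModels
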